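/- arXiv:1312.7771 — 9 statements merged into one kernel-verified Lean document; each statement's English description precedes it below -/
import Mathlib

section
/- There exists a finitely generated subgroup H of SL(2,ℤ) which has infinite index in SL(2,ℤ) and whose absolute trace set equals all of ℕ, i.e. {|tr γ| : γ ∈ H} = ℕ. -/
open scoped MatrixGroups

/-- The absolute trace set of a subgroup of `SL(2, ℤ)`, as a set of natural numbers. -/
def absTraceSet (H : Subgroup SL(2, ℤ)) : Set ℕ :=
  {n : ℕ | ∃ γ ∈ H, (Matrix.trace (γ : Matrix (Fin 2) (Fin 2) ℤ)).natAbs = n}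

open ModularGroup

section PingPong

variable {G X ι : Type*} [Group G] [MulAction G X]

/-- Reduced words in the subgroups `K i` modulo a subgroup `Z`; the index records the subgroup
containing the leftmost letter, if there is one. -/
inductive IsReducedWord (Z : Subgroup G) (K : ι → Subgroup G) : Option ι → G → Prop
  | base {z : G} (hz : z ∈ Z) : IsReducedWord Z K none z
  | step {i : ι} {s : Option ι} {a w : G} (ha : a ∈ K i) (haZ : a ∉ Z) (hs : s ≠ some i)
      (hw : IsReducedWord Z K s w) : IsReducedWord Z K (some i) (a * w)

namespace IsReducedWord

variable {Z : Subgroup G} {K : ι → Subgroup G}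

theorem central_mul (hZ : Z ≤ Subgroup.center G) {s : Option ι} {w z : G}
    (hw : IsReducedWord Z K s w) (hz : z ∈ Z) : IsReducedWord Z K s (z * w) := by
  induction hw with
  | base hz' => exact .base (mul_mem hz hz')
  | @step i s a w ha haZ hs _ ih =>
    rw [← mul_assoc, ← Subgroup.mem_center_iff.1 (hZ hz) a, mul_assoc]
    exact .step ha haZ hs ih

theorem exists_mul (hZ : Z ≤ Subgroup.center G) {s : Option ι} {w b : G} {i : ι}
    (hw : IsReducedWord Z K s w) (hb : b ∈ K i) : ∃ t, IsReducedWord Z K t (b * w) := by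
  by_cases hbZ : b ∈ Z
  · exact ⟨s, hw.central_mul hZ hbZ⟩
  by_cases hs : s = some i
  · subst hs
    cases hw with
    | @step _ s a w ha haZ hs hw =>
      rw [← mul_assoc]
      by_cases hba : b * a ∈ Z
      · exact ⟨s, hw.central_mul hZ hba⟩
      · exact ⟨some i, .step (mul_mem hb ha) hba hs hw⟩
  · exact ⟨some i, .step hb hbZ hs hw⟩

theorem exists_of_mem_iSup (hZ : Z ≤ Subgroup.center G) {g : G} (hg : g ∈ ⨆ i, K i) :
    ∃ s, IsReducedWord Z K s g := by
  rw [Subgroup.iSup_eq_closure] at hg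
  induction hg using Subgroup.closure_induction_left with
  | one => exact ⟨none, .base (one_mem Z)⟩
  | mul_left x hx y _ ih =>
    obtain ⟨s, hs⟩ := ih
    obtain ⟨i, hi⟩ := Set.mem_iUnion.1 hx
    exact hs.exists_mul hZ hi
  | inv_mul_cancel x hx y _ ih =>
    obtain ⟨s, hs⟩ := ih
    obtain ⟨i, hi⟩ := Set.mem_iUnion.1 hx
    exact hs.exists_mul hZ (inv_mem hi)

theorem smul_mem (hZ : Z ≤ Subgroup.center G) {D : ι → Set X} {x₀ : X}
    (hx₀ : ∀ i, ∀ a ∈ K i, a ∉ Z → a • x₀ ∈ D i)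
    (hD : ∀ i j, i ≠ j → ∀ a ∈ K i, a ∉ Z → ∀ x ∈ D j, a • x ∈ D i)
    (hZD : ∀ i, ∀ z ∈ Z, ∀ x ∈ D i, z • x ∈ D i) {s : Option ι} {w : G}
    (hw : IsReducedWord Z K s w) : ∀ i, s = some i → w • x₀ ∈ D i := by
  induction hw with
  | base => simp
  | @step i s a w ha haZ hs hw ih =>
    rintro _ ⟨⟩
    cases hw with
    | base hz =>
      rw [Subgroup.mem_center_iff.1 (hZ hz) a, mul_smul]
      exact hZD i _ hz _ (hx₀ i a ha haZ)
    | @step j =>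
      rw [mul_smul]
      exact hD i j (fun h => hs (h ▸ rfl)) a ha haZ _ (ih j rfl)

end IsReducedWord

/-- The ping-pong lemma modulo a central subgroup `Z`. -/
theorem mem_or_exists_smul_mem_of_mem_iSup {Z : Subgroup G} (hZ : Z ≤ Subgroup.center G)
    {K : ι → Subgroup G} {D : ι → Set X} {x₀ : X}
    (hx₀ : ∀ i, ∀ a ∈ K i, a ∉ Z → a • x₀ ∈ D i)
    (hD : ∀ i j, i ≠ j → ∀ a ∈ K i, a ∉ Z → ∀ x ∈ D j, a • x ∈ D i)
    (hZD : ∀ i, ∀ z ∈ Z, ∀ x ∈ D i, z • x ∈ D i) {g : G} (hg : g ∈ ⨆ i, K i) :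
    g ∈ Z ∨ ∃ i, g • x₀ ∈ D i := by
  obtain ⟨s, hs⟩ := IsReducedWord.exists_of_mem_iSup hZ hg
  cases s with
  | none => cases hs with | base hz => exact .inl hz
  | some i => exact .inr ⟨i, hs.smul_mem hZ hx₀ hD hZD i rfl⟩

end PingPong

/-- The value at `v` of the binary quadratic form with the given coefficients. -/
def binaryForm (f : Fin 3 → ℤ) (v : Fin 2 → ℤ) : ℤ :=
  f 0 * v 0 ^ 2 + f 1 * (v 0 * v 1) + f 2 * v 1 ^ 2

theorem binaryForm_add_nonpos {f g : Fin 3 → ℤ} (h₀ : f 0 + g 0 < 0)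
    (h : (f 1 + g 1) ^ 2 ≤ 4 * (f 0 + g 0) * (f 2 + g 2)) (v : Fin 2 → ℤ) :
    binaryForm f v + binaryForm g v ≤ 0 := by
  have key : 0 ≤ 4 * (f 0 + g 0) * (binaryForm f v + binaryForm g v) := by
    have h₁ := mul_nonneg (sub_nonneg.2 h) (sq_nonneg (v 1))
    have h₂ := sq_nonneg (2 * (f 0 + g 0) * v 0 + (f 1 + g 1) * v 1)
    unfold binaryForm
    linarith
  by_contra! hpos
  nlinarith

theorem binaryForm_smul_of_mem_center (f : Fin 3 → ℤ) {z : SL(2, ℤ)}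
    (hz : z ∈ Subgroup.center SL(2, ℤ)) (v : Fin 2 → ℤ) :
    binaryForm f (z • v) = binaryForm f v := by
  obtain ⟨r, hr, hrz⟩ := Matrix.SpecialLinearGroup.mem_center_iff.1 hz
  have hr : r ^ 2 = 1 := by simpa using hr
  have hv : z • v = r • v := by
    rw [Matrix.SpecialLinearGroup.smul_def, ← hrz]
    simp
  rw [hv]
  simp only [binaryForm, Pi.smul_apply, smul_eq_mul]
  linear_combination (f 0 * v 0 ^ 2 + f 1 * (v 0 * v 1) + f 2 * v 1 ^ 2) * hr

/-- Every non-central power of `a` maps the region `f < 0` into the region `f > 0`. -/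
def FlipsSign (a : SL(2, ℤ)) (f : Fin 3 → ℤ) : Prop :=
  ∀ k : ℤ, a ^ k ∈ Subgroup.center SL(2, ℤ) ∨
    ∀ v, binaryForm f v < 0 → 0 < binaryForm f (a ^ k • v)

theorem FlipsSign.conj {a : SL(2, ℤ)} {f : Fin 3 → ℤ} (h : FlipsSign a f) (c : SL(2, ℤ))
    {f' : Fin 3 → ℤ} {m : ℤ} (hm : 0 < m)
    (hf : ∀ v, binaryForm f' v = m * binaryForm f (c⁻¹ • v)) :
    FlipsSign (c * a * c⁻¹) f' := by
  intro k
  rw [conj_zpow]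
  refine (h k).imp (fun hk => ?_) fun hk v hv => ?_
  · exact (inferInstance : (Subgroup.center SL(2, ℤ)).Normal).conj_mem _ hk c
  · rw [hf] at hv ⊢
    rw [mul_assoc, mul_smul, inv_smul_smul, mul_smul]
    exact mul_pos hm (hk _ (by nlinarith))

theorem lt_sq_add_mul {a b k : ℤ} (h : a ^ 2 < b ^ 2) (hk : k ≠ 0) :
    b ^ 2 < (a + 2 * k * b) ^ 2 := by
  rw [sq_lt_sq] at h ⊢
  have h₁ : |2 * k * b| ≤ |a + 2 * k * b| + |a| := by
    simpa using abs_sub (a + 2 * k * b) a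
  have h₂ : |2 * k * b| = 2 * (|k| * |b|) := by rw [abs_mul, abs_mul, abs_two, mul_assoc]
  have h₃ : |b| ≤ |k| * |b| := le_mul_of_one_le_left (abs_nonneg b) (Int.one_le_abs hk)
  linarith

theorem flipsSign_T_pow_five : FlipsSign (T ^ 5) ![1, -1, -6] := by
  intro k
  by_cases hk : k = 0
  · exact .inl (by simp [hk])
  refine .inr fun v hv => ?_
  rw [← zpow_natCast, ← zpow_mul, Nat.cast_ofNat, Matrix.SpecialLinearGroup.smul_def]
  have := lt_sq_add_mul (a := 2 * v 0 - v 1) (b := 5 * v 1) (k := k)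
    (by simp [binaryForm] at hv; linarith) hk
  simp [binaryForm, coe_T_zpow, Matrix.mulVec, dotProduct, Fin.sum_univ_two] at this ⊢
  linarith

theorem coe_T_mul_S_mul_T_zpow (k : ℤ) :
    ((T * S * T) ^ k : SL(2, ℤ)).1 = !![1, 0; k, 1] := by
  have h : T * S * T = S * T⁻¹ * S⁻¹ := by decide
  rw [h, conj_zpow, inv_zpow', Matrix.SpecialLinearGroup.coe_mul, Matrix.SpecialLinearGroup.coe_mul,
    coe_T_zpow, S_inv]
  simp [coe_S]

theorem flipsSign_T_mul_S_mul_T : FlipsSign (T * S * T) ![-1, 0, 4] := by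
  intro k
  by_cases hk : k = 0
  · exact .inl (by simp [hk])
  refine .inr fun v hv => ?_
  rw [Matrix.SpecialLinearGroup.smul_def, coe_T_mul_S_mul_T_zpow]
  have := lt_sq_add_mul (a := 2 * v 1) (b := v 0) (k := k)
    (by simp [binaryForm] at hv; linarith) hk
  simp [binaryForm, Matrix.mulVec, dotProduct, Fin.sum_univ_two]
  linarith

theorem neg_one_mem_center : (-1 : SL(2, ℤ)) ∈ Subgroup.center SL(2, ℤ) :=
  Subgroup.mem_center_iff.2 fun g => by simp

theorem S_zpow_eq (k : ℤ) : S ^ k = 1 ∨ S ^ k = -1 ∨ S ^ k = S ∨ S ^ k = -S := by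
  induction k with
  | zero => simp
  | succ n ih =>
    rw [zpow_add_one]
    rcases ih with h | h | h | h <;> rw [h] <;> decide
  | pred n ih =>
    rw [zpow_sub_one]
    rcases ih with h | h | h | h <;> rw [h] <;> decide

theorem flipsSign_S : FlipsSign S ![-1, 0, 1] := by
  intro k
  rcases S_zpow_eq k with h | h | h | h <;> rw [h]
  · exact .inl (one_mem _)
  · exact .inl neg_one_mem_center
  all_goals
    refine .inr fun v hv => ?_
    rw [Matrix.SpecialLinearGroup.smul_def]
    simp [binaryForm, coe_S, Matrix.mulVec, dotProduct, Fin.sum_univ_two] at hv ⊢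
    linarith

theorem T_mul_S_zpow_eq (k : ℤ) : (T * S) ^ k = 1 ∨ (T * S) ^ k = -1 ∨ (T * S) ^ k = T * S ∨
    (T * S) ^ k = -(T * S) ∨ (T * S) ^ k = (T * S) ^ 2 ∨ (T * S) ^ k = -(T * S) ^ 2 := by
  induction k with
  | zero => simp
  | succ n ih =>
    rw [zpow_add_one]
    rcases ih with h | h | h | h | h | h <;> rw [h] <;> decide
  | pred n ih =>
    rw [zpow_sub_one]
    rcases ih with h | h | h | h | h | h <;> rw [h] <;> decide

theorem flipsSign_T_mul_S : FlipsSign (T * S) ![-1, 1, 2] := by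
  intro k
  rcases T_mul_S_zpow_eq k with h | h | h | h | h | h <;> rw [h]
  · exact .inl (one_mem _)
  · exact .inl neg_one_mem_center
  all_goals
    refine .inr fun v hv => ?_
    rw [Matrix.SpecialLinearGroup.smul_def]
    simp [binaryForm, coe_S, coe_T, pow_two, Matrix.mulVec, dotProduct, Fin.sum_univ_two] at hv ⊢
    nlinarith

/-- Elements conjugating the three building blocks into ping-pong position. -/
def blockConj : Fin 3 → SL(2, ℤ) :=
  ![1, ⟨!![-3, 8; -2, 5], by decide⟩, ⟨!![-3, 7; 2, -5], by decide⟩]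

/-- Elements which, together with `T ^ 5`, generate the three building blocks; their traces
are `0`, `1` and `2`. -/
def blockElt : Fin 3 → SL(2, ℤ) := ![S, T * S, T * S * T]

/-- The generators of the thin subgroup. -/
def thinGen : Fin 3 ⊕ Fin 3 → SL(2, ℤ) :=
  Sum.elim (fun i => blockConj i * T ^ 5 * (blockConj i)⁻¹)
    (fun i => blockConj i * blockElt i * (blockConj i)⁻¹)

/-- Coefficients of indefinite forms, scaled to a common discriminant, whose positive regions are
ping-pong domains for the generators. -/
def thinForm : Fin 3 ⊕ Fin 3 → Fin 3 → ℤ :=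
  Sum.elim ![![12, -12, -72], ![-108, 276, -168], ![-108, -372, -312]]
    ![![-30, 0, 30], ![-140, 500, -440], ![-135, -330, -195]]

/-- A finitely generated subgroup of infinite index containing elements of every trace. -/
def thinSubgroup : Subgroup SL(2, ℤ) := ⨆ i, Subgroup.zpowers (thinGen i)

theorem coe_blockConj_inv : ∀ i, ((blockConj i)⁻¹ : SL(2, ℤ)).1 =
    ![1, !![5, -8; 2, -3], !![-5, -7; -2, -3]] i := by
  decide

theorem flipsSign_thinGen (i : Fin 3 ⊕ Fin 3) : FlipsSign (thinGen i) (thinForm i) := by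
  rcases i with i | i
  · refine flipsSign_T_pow_five.conj (blockConj i) (m := 12) (by norm_num) fun v => ?_
    rw [Matrix.SpecialLinearGroup.smul_def, coe_blockConj_inv]
    fin_cases i <;>
      simp [thinForm, binaryForm, Matrix.mulVec, dotProduct, Fin.sum_univ_two] <;> ring
  · fin_cases i
    · refine flipsSign_S.conj (blockConj 0) (m := 30) (by norm_num) fun v => ?_
      rw [Matrix.SpecialLinearGroup.smul_def, coe_blockConj_inv]
      simp [thinForm, binaryForm]
      ring
    · refine flipsSign_T_mul_S.conj (blockConj 1) (m := 20) (by norm_num) fun v => ?_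
      rw [Matrix.SpecialLinearGroup.smul_def, coe_blockConj_inv]
      simp [thinForm, binaryForm, Matrix.mulVec, dotProduct, Fin.sum_univ_two]
      ring
    · refine flipsSign_T_mul_S_mul_T.conj (blockConj 2) (m := 15) (by norm_num) fun v => ?_
      rw [Matrix.SpecialLinearGroup.smul_def, coe_blockConj_inv]
      simp [thinForm, binaryForm, Matrix.mulVec, dotProduct, Fin.sum_univ_two]
      ring

theorem thinForm_add_nonpos {i j : Fin 3 ⊕ Fin 3} (hij : i ≠ j) (v : Fin 2 → ℤ) :
    binaryForm (thinForm i) v + binaryForm (thinForm j) v ≤ 0 := by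
  have h : ∀ i j : Fin 3 ⊕ Fin 3, i ≠ j → thinForm i 0 + thinForm j 0 < 0 ∧
      (thinForm i 1 + thinForm j 1) ^ 2 ≤
        4 * (thinForm i 0 + thinForm j 0) * (thinForm i 2 + thinForm j 2) := by decide
  exact binaryForm_add_nonpos (h i j hij).1 (h i j hij).2 v

theorem thinForm_base_neg : ∀ i, binaryForm (thinForm i) ![5, 2] < 0 := by decide

theorem mem_center_or_of_mem_thinSubgroup {g : SL(2, ℤ)} (hg : g ∈ thinSubgroup) :
    g ∈ Subgroup.center SL(2, ℤ) ∨ ∃ i, 0 < binaryForm (thinForm i) (g • ![5, 2]) := by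
  have flip {i a} (ha : a ∈ Subgroup.zpowers (thinGen i)) (haZ : a ∉ Subgroup.center SL(2, ℤ))
      (v) (hv : binaryForm (thinForm i) v < 0) : 0 < binaryForm (thinForm i) (a • v) := by
    obtain ⟨k, rfl⟩ := Subgroup.mem_zpowers_iff.1 ha
    exact (flipsSign_thinGen i k).resolve_left haZ v hv
  refine mem_or_exists_smul_mem_of_mem_iSup le_rfl
    (D := fun i => {v | 0 < binaryForm (thinForm i) v})
    (fun i a ha haZ => flip ha haZ _ (thinForm_base_neg i))
    (fun i j hij a ha haZ v hv => flip ha haZ v ?_) (fun i z hz v hv => ?_) hg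
  · have := thinForm_add_nonpos hij v
    rw [Set.mem_ofPred_eq] at hv
    linarith
  · rwa [Set.mem_ofPred_eq, binaryForm_smul_of_mem_center _ hz]

theorem thinSubgroup_fg : thinSubgroup.FG := by
  refine Subgroup.FG.iSup _ fun i => ?_
  rw [Subgroup.zpowers_eq_closure]
  exact (Subgroup.fg_iff _).2 ⟨_, rfl, Set.finite_singleton _⟩

theorem thinSubgroup_index : thinSubgroup.index = 0 := by
  by_contra h
  let p : SL(2, ℤ) := ⟨!![-9, 25; -4, 11], by decide⟩
  obtain ⟨n, hn, -, hpn⟩ := Subgroup.exists_pow_mem_of_index_ne_zero h p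
  have hp : p • ![5, 2] = ![(5 : ℤ), 2] := by decide
  have hfix : p ^ n • ![5, 2] = ![(5 : ℤ), 2] := by
    clear hn hpn
    induction n with
    | zero => simp
    | succ n ih => rw [pow_succ, mul_smul, hp, ih]
  have hval : ∀ n : ℕ, (p ^ n).1 = !![1 - 10 * (n : ℤ), 25 * n; -4 * n, 1 + 10 * n] := by
    intro n
    induction n with
    | zero => simp [Matrix.one_fin_two]
    | succ n ih =>
      rw [pow_succ, Matrix.SpecialLinearGroup.coe_mul, ih]
      ext i j
      fin_cases i <;> fin_cases j <;> simp [p] <;> ring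
  rcases mem_center_or_of_mem_thinSubgroup hpn with hz | ⟨i, hi⟩
  · obtain ⟨r, -, hr⟩ := Matrix.SpecialLinearGroup.mem_center_iff.1 hz
    have := congr_fun₂ (hr.trans (hval n)) 1 0
    rw [Matrix.scalar_apply, Matrix.diagonal_apply_ne _ (by decide)] at this
    simp at this
    omega
  · rw [hfix] at hi
    exact (thinForm_base_neg i).not_gt hi

theorem exists_mem_thinSubgroup_trace (i : Fin 3) (k : ℤ) :
    ∃ γ ∈ thinSubgroup, (γ : Matrix (Fin 2) (Fin 2) ℤ).trace = 5 * k + i := by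
  have hmem (j) : thinGen j ∈ thinSubgroup :=
    Subgroup.mem_iSup_of_mem j (Subgroup.mem_zpowers _)
  refine ⟨_, mul_mem (zpow_mem (hmem (.inl i)) k) (hmem (.inr i)), ?_⟩
  have h : thinGen (.inl i) ^ k * thinGen (.inr i) =
      blockConj i * (T ^ (5 * k) * blockElt i) * (blockConj i)⁻¹ := by
    simp only [thinGen, Sum.elim_inl, Sum.elim_inr, conj_zpow, zpow_mul]
    group
  rw [h, Matrix.SpecialLinearGroup.coe_mul, Matrix.trace_mul_comm, ← Matrix.SpecialLinearGroup.coe_mul,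
    inv_mul_cancel_left, Matrix.SpecialLinearGroup.coe_mul, coe_T_zpow]
  fin_cases i <;> simp [blockElt, coe_S, coe_T, Matrix.trace_fin_two] <;> ring

theorem absTraceSet_thinSubgroup : absTraceSet thinSubgroup = Set.univ := by
  refine Set.eq_univ_of_forall fun n => ?_
  have h (i : Fin 3) (k : ℤ) (hk : (5 * k + (i : ℕ)).natAbs = n) :
      n ∈ absTraceSet thinSubgroup := by
    obtain ⟨γ, hγ, ht⟩ := exists_mem_thinSubgroup_trace i k
    exact ⟨γ, hγ, by rw [ht]; exact hk⟩
  have hmod : n % 5 = 0 ∨ n % 5 = 1 ∨ n % 5 = 2 ∨ n % 5 = 3 ∨ n % 5 = 4 := by omega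
  rcases hmod with hn | hn | hn | hn | hn
  · exact h 0 (n / 5) (by simp; omega)
  · exact h 1 (n / 5) (by simp; omega)
  · exact h 2 (n / 5) (by simp; omega)
  · exact h 2 (-(n / 5) - 1) (by simp; omega)
  · exact h 1 (-(n / 5) - 1) (by simp; omega)

/-- There exists a finitely generated subgroup of `SL(2, ℤ)` of infinite index whose
absolute trace set is all of `ℕ`. -/
theorem exists_fg_infinite_index_subgroup_with_full_trace_set :
    ∃ H : Subgroup SL(2, ℤ), H.FG ∧ H.index = 0 ∧ absTraceSet H = Set.univ := by
  exact ⟨thinSubgroup, thinSubgroup_fg, thinSubgroup_index, absTraceSet_thinSubgroup⟩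
end

section
/- The set of finite-index subgroups K of SL(2,ℤ) whose absolute trace set equals all of ℕ, i.e. {|tr γ| : γ ∈ K} = ℕ, is infinite. -/
open scoped MatrixGroups

namespace FullTraceSet

open ModularGroup Monoid

/-! ### The modular group as a free product -/

section FreeProduct

/-- The homomorphism from the cyclic group of order `n` sending a generator to `g`. -/
def zmodPow {G : Type*} [Group G] (n : ℕ) (g : G) (hg : g ^ n = 1) :
    Multiplicative (ZMod n) →* G :=
  AddMonoidHom.toMultiplicativeLeft
    (ZMod.lift n ⟨zmultiplesHom (Additive G) (Additive.ofMul g), by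
      rw [zmultiplesHom_apply, natCast_zsmul, ← ofMul_pow, hg, ofMul_one]⟩)

lemma zmodPow_ofAdd_natCast {G : Type*} [Group G] (n : ℕ) (g : G) (hg : g ^ n = 1) (k : ℕ) :
    zmodPow n g hg (Multiplicative.ofAdd (k : ZMod n)) = g ^ k := by
  have := ZMod.lift_coe n ⟨zmultiplesHom (Additive G) (Additive.ofMul g), by
      rw [zmultiplesHom_apply, natCast_zsmul, ← ofMul_pow, hg, ofMul_one]⟩ (k : ℤ)
  rw [Int.cast_natCast] at this
  simp [zmodPow, this]

/-- The cyclic factors, of orders two and three, of the modular group. -/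
abbrev Factor (b : Bool) : Type := Multiplicative (ZMod (cond b 2 3))

/-- The maps out of the cyclic factors determined by an element of order dividing two and one of
order dividing three. -/
def factorHom {G : Type*} [Group G] (x y : G) (hx : x ^ 2 = 1) (hy : y ^ 3 = 1) (b : Bool) :
    Factor b →* G :=
  zmodPow (cond b 2 3) (cond b x y) (by cases b <;> assumption)

lemma exists_factorHom_eq {G : Type*} [Group G] (x y : G) (hx : x ^ 2 = 1) (hy : y ^ 3 = 1)
    (b : Bool) (h : Factor b) (h1 : h ≠ 1) :
    (b = true ∧ factorHom x y hx hy b h = x) ∨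
      (b = false ∧ (factorHom x y hx hy b h = y ∨ factorHom x y hx hy b h = y ^ 2)) := by
  cases b
  · refine Or.inr ⟨rfl, ?_⟩
    have key : ∀ z : ZMod 3, z ≠ 0 → z = ((1 : ℕ) : ZMod 3) ∨ z = ((2 : ℕ) : ZMod 3) := by decide
    rcases key h.toAdd (fun e => h1 e) with e | e
    · left
      have := zmodPow_ofAdd_natCast 3 y hy 1
      rw [← e, pow_one] at this
      exact this
    · right
      have := zmodPow_ofAdd_natCast 3 y hy 2
      rw [← e] at this
      exact this
  · refine Or.inl ⟨rfl, ?_⟩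
    have key : ∀ z : ZMod 2, z ≠ 0 → z = ((1 : ℕ) : ZMod 2) := by decide
    have := zmodPow_ofAdd_natCast 2 x hx 1
    rw [← key h.toAdd (fun e => h1 e), pow_one] at this
    exact this

lemma lift_factorHom_of {G : Type*} [Group G] (x y : G) (hx : x ^ 2 = 1) (hy : y ^ 3 = 1) :
    CoprodI.lift (factorHom x y hx hy)
        (CoprodI.of (i := true) (Multiplicative.ofAdd ((1 : ℕ) : ZMod 2))) = x ∧
      CoprodI.lift (factorHom x y hx hy)
        (CoprodI.of (i := false) (Multiplicative.ofAdd ((1 : ℕ) : ZMod 3))) = y := by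
  rw [CoprodI.lift_of, CoprodI.lift_of]
  exact ⟨(zmodPow_ofAdd_natCast 2 x hx 1).trans (pow_one x),
    (zmodPow_ofAdd_natCast 3 y hy 1).trans (pow_one y)⟩

/-- The action of `SL(2, ℤ)` on bilinear forms, `γ • M = γ M γᵀ`; it factors through
`PSL(2, ℤ)`. -/
def formAction : SL(2, ℤ) →* Equiv.Perm (Matrix (Fin 2) (Fin 2) ℤ) :=
  MonoidHom.toHomPerm
    { toFun := fun γ M => γ.1 * M * γ.1.transpose
      map_one' := by
        funext M
        change (1 : Matrix (Fin 2) (Fin 2) ℤ) * M * (1 : Matrix (Fin 2) (Fin 2) ℤ).transpose = M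
        simp
      map_mul' := fun γ δ => by
        funext M
        change (γ.1 * δ.1) * M * (γ.1 * δ.1).transpose =
          γ.1 * (δ.1 * M * δ.1.transpose) * γ.1.transpose
        simp only [Matrix.transpose_mul, Matrix.mul_assoc] }

lemma formAction_apply (γ : SL(2, ℤ)) (M : Matrix (Fin 2) (Fin 2) ℤ) :
    formAction γ M = γ.1 * M * γ.1.transpose := rfl

lemma formAction_S (M : Matrix (Fin 2) (Fin 2) ℤ) :
    formAction S M = !![M 1 1, -M 1 0; -M 0 1, M 0 0] := by
  rw [formAction_apply, coe_S]
  ext i j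
  fin_cases i <;> fin_cases j <;>
    simp [Matrix.mul_apply, Fin.sum_univ_two, Matrix.vecMul, Matrix.vecHead, Matrix.vecTail]

lemma formAction_TS (M : Matrix (Fin 2) (Fin 2) ℤ) :
    formAction (T * S) M =
      !![M 0 0 - M 0 1 - M 1 0 + M 1 1, M 0 0 - M 1 0; M 0 0 - M 0 1, M 0 0] := by
  rw [map_mul, Equiv.Perm.mul_apply, formAction_S, formAction_apply, coe_T]
  ext i j
  fin_cases i <;> fin_cases j <;>
    simp [Matrix.mul_apply, Fin.sum_univ_two] <;> ring

lemma formAction_S_sq : formAction S ^ 2 = 1 := by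
  ext M i j
  rw [sq, Equiv.Perm.mul_apply, formAction_S, formAction_S]
  fin_cases i <;> fin_cases j <;> simp

lemma formAction_TS_cube : formAction (T * S) ^ 3 = 1 := by
  ext M i j
  rw [pow_succ, sq, Equiv.Perm.mul_apply, Equiv.Perm.mul_apply, formAction_TS, formAction_TS,
    formAction_TS]
  fin_cases i <;> fin_cases j <;> simp <;> ring

/-- The ping-pong sets: forms with positive diagonal whose off-diagonal entries are both negative
(for the factor of order two), or both positive (for the factor of order three). -/
def pingPongSet (b : Bool) : Set (Matrix (Fin 2) (Fin 2) ℤ) :=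
  {M | 0 < M 0 0 ∧ 0 < M 1 1 ∧ 0 < cond b (-M 0 1) (M 0 1) ∧ 0 < cond b (-M 1 0) (M 1 0)}

lemma lift_factorHom_formAction_injective :
    Function.Injective
      (CoprodI.lift (factorHom _ _ formAction_S_sq formAction_TS_cube)) := by
  refine CoprodI.lift_injective_of_ping_pong _ (Or.inr ⟨false, ?_⟩) pingPongSet ?_ ?_ ?_
  · change 3 ≤ Cardinal.mk (ZMod 3)
    simp
  · rintro (_ | _)
    · exact ⟨!![1, 1; 1, 1], by simp [pingPongSet]⟩
    · exact ⟨!![1, -1; -1, 1], by simp [pingPongSet]⟩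
  · intro b c hbc
    rw [Function.onFun, Set.disjoint_left]
    intro M hb hc
    cases b <;> cases c <;> simp [pingPongSet] at hbc hb hc <;> omega
  · rintro b c hbc h h1 _ ⟨M, hM, rfl⟩
    rcases exists_factorHom_eq _ _ formAction_S_sq formAction_TS_cube b h h1 with
      ⟨rfl, e⟩ | ⟨rfl, e | e⟩
    · obtain rfl : c = false := by cases c <;> simp_all
      simp only [e, Equiv.Perm.smul_def, formAction_S]
      simp [pingPongSet] at hM ⊢
      omega
    · obtain rfl : c = true := by cases c <;> simp_all
      simp only [e, Equiv.Perm.smul_def, formAction_TS]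
      simp [pingPongSet] at hM ⊢
      omega
    · obtain rfl : c = true := by cases c <;> simp_all
      simp only [e, Equiv.Perm.smul_def, sq, Equiv.Perm.mul_apply, formAction_TS]
      simp [pingPongSet] at hM ⊢
      omega

/-- Universal property of the modular group `PSL(2, ℤ) ≅ ℤ/2 * ℤ/3`. -/
theorem exists_hom_of_sq_eq_one_of_cube_eq_one {G : Type*} [Group G] (x y : G)
    (hx : x ^ 2 = 1) (hy : y ^ 3 = 1) :
    ∃ Φ : SL(2, ℤ) →* G, Φ S = x ∧ Φ (T * S) = y := by
  let L := CoprodI.lift (factorHom _ _ formAction_S_sq formAction_TS_cube)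
  have hinj : Function.Injective L := lift_factorHom_formAction_injective
  have hS := (lift_factorHom_of _ _ formAction_S_sq formAction_TS_cube).1
  have hTS := (lift_factorHom_of _ _ formAction_S_sq formAction_TS_cube).2
  have hrange : ∀ γ, formAction γ ∈ L.range := by
    suffices (⊤ : Subgroup SL(2, ℤ)) ≤ L.range.comap formAction from fun γ => this trivial
    rw [← SpecialLinearGroup.SL2Z_generators, Subgroup.closure_le]
    have hS' : formAction S ∈ L.range := ⟨_, hS⟩
    rintro γ (rfl | rfl)
    · exact hS'
    · have : formAction (T * S) ∈ L.range := ⟨_, hTS⟩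
      rw [map_mul] at this
      exact (Subgroup.mul_mem_cancel_right _ hS').1 this
  let e := MonoidHom.ofInjective hinj
  have hsymm : ∀ γ c, L c = formAction γ → e.symm (formAction.codRestrict L.range hrange γ) = c :=
    fun γ c h => (MulEquiv.symm_apply_eq e).2 (Subtype.ext h.symm)
  refine ⟨((CoprodI.lift (factorHom x y hx hy)).comp e.symm.toMonoidHom).comp
    (formAction.codRestrict L.range hrange), ?_, ?_⟩
  · exact (congrArg _ (hsymm _ _ hS)).trans (lift_factorHom_of x y hx hy).1
  · exact (congrArg _ (hsymm _ _ hTS)).trans (lift_factorHom_of x y hx hy).2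

end FreeProduct

/-! ### A family of permutation representations -/

section Permutations

/-- The involution on `25` points by which `S` acts. -/
def sigma : Fin 25 → Fin 25 :=
  ![5, 22, 21, 14, 18, 0, 6, 16, 17, 23, 12, 19, 10, 24, 3, 20, 7, 8, 4, 11, 15, 2, 1, 9, 13]

/-- The permutation of order three on `25` points by which `T * S` acts. -/
def rho (i : Fin 25) : Fin 25 :=
  if i = 0 then 0 else if i.val % 3 = 0 then i - 2 else i + 1

/-- The cocycle defining the cyclic covers of the permutation representation on `25` points: it is
supported on a single edge. -/
def voltage (i : Fin 25) : ℤ :=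
  if i = 3 then 1 else if i = 14 then -1 else 0

/-- The action of the generators (`true` stands for `S`, `false` for `T * S`) on the infinite
cyclic cover. -/
def step (b : Bool) (p : Fin 25 × ℤ) : Fin 25 × ℤ :=
  cond b (sigma p.1, p.2 + voltage p.1) (rho p.1, p.2)

/-- The generators acting on the cyclic cover of degree `N`. -/
def coverPerm (N : ℕ) (b : Bool) : Equiv.Perm (Fin 25 × ZMod N) :=
  match b with
  | true =>
    Function.Involutive.toPerm (fun p => (sigma p.1, p.2 + (voltage p.1 : ZMod N))) fun p => by
      have h1 : ∀ i, sigma (sigma i) = i := by decide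
      have h2 : ∀ i, voltage i + voltage (sigma i) = 0 := by decide
      ext1
      · exact h1 p.1
      · simp [add_assoc, ← Int.cast_add, h2]
  | false =>
    { toFun := fun p => (rho p.1, p.2)
      invFun := fun p => (rho (rho p.1), p.2)
      left_inv := fun p => Prod.ext ((by decide : ∀ i, rho (rho (rho i)) = i) p.1) rfl
      right_inv := fun p => Prod.ext ((by decide : ∀ i, rho (rho (rho i)) = i) p.1) rfl }

lemma coverPerm_true_apply (N : ℕ) (p : Fin 25 × ZMod N) :
    coverPerm N true p = (sigma p.1, p.2 + (voltage p.1 : ZMod N)) := rfl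

lemma coverPerm_true_sq (N : ℕ) : coverPerm N true ^ 2 = 1 := by
  ext1 p
  rw [sq, Equiv.Perm.mul_apply]
  exact (coverPerm N true).left_inv p

lemma coverPerm_false_cube (N : ℕ) : coverPerm N false ^ 3 = 1 := by
  ext1 p
  exact Prod.ext ((by decide : ∀ i, rho (rho (rho i)) = i) p.1) rfl

lemma prod_map_coverPerm_apply (N : ℕ) (l : List Bool) (i : Fin 25) (a : ZMod N) :
    (l.map (coverPerm N)).prod (i, a) =
      ((l.foldr step (i, 0)).1, a + ((l.foldr step (i, 0)).2 : ZMod N)) := by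
  induction l with
  | nil => simp
  | cons b l ih =>
    rw [List.map_cons, List.prod_cons, Equiv.Perm.mul_apply, ih, List.foldr_cons]
    cases b
    · rfl
    · simp [step, coverPerm_true_apply, add_assoc]

/-- The word in the generators representing `T ^ k * S`. -/
def traceWord (k : ℕ) : List Bool :=
  (List.replicate k [false, true]).flatten ++ [true]

lemma prod_map_flatten_replicate (N k : ℕ) :
    ((List.replicate k [false, true]).flatten.map (coverPerm N)).prod =
      (coverPerm N false * coverPerm N true) ^ k := by
  simp [List.prod_flatten]

lemma prod_map_traceWord (N k : ℕ) :
    ((traceWord k).map (coverPerm N)).prod =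
      (coverPerm N false * coverPerm N true) ^ k * coverPerm N true := by
  rw [traceWord, List.map_append, List.prod_append, prod_map_flatten_replicate]
  simp

/-- A point of the permutation representation on `25` points fixed by `T ^ k * S`, for
`k` modulo `7`. -/
def fixedPoint : Fin 7 → Fin 25 := ![6, 0, 11, 18, 4, 19, 5]

/-- A closed walk starting at `0`, visiting every point, and of total voltage `-1`. -/
def tour : List Bool :=
  (List.replicate 8 [false, false, true, false, true, false, false, true, false, true, false, true,
    false, true]).flatten

lemma foldr_tour : tour.foldr step (0, 0) = (0, -1) := by decide +kernel

lemma exists_foldr_drop_tour (i : Fin 25) :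
    ∃ n ∈ List.range tour.length, ((tour.drop n).foldr step (0, 0)).1 = i := by
  revert i
  decide +kernel

variable {N : ℕ} {Φ : SL(2, ℤ) →* Equiv.Perm (Fin 25 × ZMod N)}

lemma exists_map_eq_prod (hS : Φ S = coverPerm N true) (hR : Φ (T * S) = coverPerm N false)
    (l : List Bool) : ∃ γ, Φ γ = (l.map (coverPerm N)).prod := by
  refine ⟨(l.map fun b => cond b S (T * S)).prod, ?_⟩
  rw [map_list_prod, List.map_map]
  congr 2
  funext b
  cases b
  · exact hR
  · exact hS

lemma exists_map_apply_eq [NeZero N] (hS : Φ S = coverPerm N true)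
    (hR : Φ (T * S) = coverPerm N false) (p : Fin 25 × ZMod N) : ∃ γ, Φ γ (0, 0) = p := by
  obtain ⟨δ, hδ⟩ := exists_map_eq_prod hS hR tour
  have hpow : ∀ k : ℕ, Φ (δ ^ k) (0, 0) = (0, -(k : ZMod N)) := by
    intro k
    induction k with
    | zero => simp
    | succ k ih =>
      rw [pow_succ', map_mul, Equiv.Perm.mul_apply, ih, hδ, prod_map_coverPerm_apply, foldr_tour]
      simp [add_comm]
  obtain ⟨i, a⟩ := p
  obtain ⟨n, -, hn⟩ := exists_foldr_drop_tour i
  obtain ⟨ε, hε⟩ := exists_map_eq_prod hS hR (tour.drop n)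
  set t : ZMod N := (((tour.drop n).foldr step (0, 0)).2 : ZMod N) with ht
  refine ⟨ε * δ ^ (t - a).val, ?_⟩
  rw [map_mul, Equiv.Perm.mul_apply, hpow, hε, prod_map_coverPerm_apply, hn, ← ht,
    ZMod.natCast_zmod_val]
  simp

lemma exists_map_T_pow_mul_S_apply_eq (hS : Φ S = coverPerm N true)
    (hR : Φ (T * S) = coverPerm N false) (n : ℕ) : ∃ p, Φ (T ^ n * S) p = p := by
  have hT : Φ T = coverPerm N false * coverPerm N true := by
    have : coverPerm N true * coverPerm N true = 1 := by rw [← sq, coverPerm_true_sq]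
    rw [← hR, map_mul, hS, mul_assoc, this, mul_one]
  have hword : ∀ k : ℕ, Φ (T ^ k * S) = ((traceWord k).map (coverPerm N)).prod := fun k => by
    rw [prod_map_traceWord, map_mul, map_pow, hT, hS]
  have hT7 : ∀ k : Fin 7, (Φ T ^ 7) (fixedPoint k, 0) = (fixedPoint k, 0) := by
    intro k
    have key : ∀ k : Fin 7, (List.replicate 7 [false, true]).flatten.foldr step (fixedPoint k, 0) =
        (fixedPoint k, 0) := by decide +kernel
    have h := prod_map_coverPerm_apply N (List.replicate 7 [false, true]).flatten
      (fixedPoint k) 0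
    rw [key k, prod_map_flatten_replicate] at h
    simpa [hT] using h
  have hfix : ∀ k : Fin 7, Φ (T ^ k.val * S) (fixedPoint k, 0) = (fixedPoint k, 0) := by
    intro k
    have key : ∀ k : Fin 7, (traceWord k).foldr step (fixedPoint k, 0) = (fixedPoint k, 0) := by
      decide +kernel
    rw [hword, prod_map_coverPerm_apply, key k]
    simp
  let k : Fin 7 := ⟨n % 7, Nat.mod_lt _ (by norm_num)⟩
  refine ⟨(fixedPoint k, 0), ?_⟩
  have hn : T ^ n * S = (T ^ 7) ^ (n / 7) * (T ^ k.val * S) := by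
    rw [← mul_assoc, ← pow_mul, ← pow_add, Nat.div_add_mod]
  rw [hn, map_mul, Equiv.Perm.mul_apply, hfix, map_pow, map_pow]
  exact Function.IsFixedPt.perm_pow (hT7 k) _

end Permutations

lemma trace_T_pow_mul_S (n : ℕ) :
    Matrix.trace ((T ^ n * S : SL(2, ℤ)) : Matrix (Fin 2) (Fin 2) ℤ) = n := by
  have h := coe_T_zpow n
  rw [zpow_natCast] at h
  rw [Matrix.SpecialLinearGroup.coe_mul, h, coe_S]
  simp [Matrix.trace_fin_two]

theorem exists_full_trace_set_of_index (N : ℕ) [NeZero N] :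
    ∃ K : Subgroup SL(2, ℤ), K.index = 25 * N ∧ absTraceSet K = Set.univ := by
  obtain ⟨Φ, hS, hR⟩ := exists_hom_of_sq_eq_one_of_cube_eq_one _ _
    (coverPerm_true_sq N) (coverPerm_false_cube N)
  let : MulAction SL(2, ℤ) (Fin 25 × ZMod N) := MulAction.compHom _ Φ
  have hsmul : ∀ (γ : SL(2, ℤ)) (p : Fin 25 × ZMod N), γ • p = Φ γ p := fun _ _ => rfl
  have : MulAction.IsPretransitive SL(2, ℤ) (Fin 25 × ZMod N) :=
    MulAction.isPretransitive_iff_base (0, 0) |>.2 (exists_map_apply_eq hS hR)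
  refine ⟨MulAction.stabilizer _ ((0, 0) : Fin 25 × ZMod N), ?_, ?_⟩
  · rw [MulAction.index_stabilizer_of_transitive]
    simp
  · refine Set.eq_univ_of_forall fun n => ?_
    obtain ⟨p, hp⟩ := exists_map_T_pow_mul_S_apply_eq hS hR n
    obtain ⟨γ, hγ⟩ := exists_map_apply_eq hS hR p
    refine ⟨γ⁻¹ * (T ^ n * S) * γ, ?_, ?_⟩
    · rw [MulAction.mem_stabilizer_iff, mul_smul, mul_smul, inv_smul_eq_iff, hsmul γ, hγ, hsmul, hp]
    · rw [Matrix.SpecialLinearGroup.coe_mul, Matrix.trace_mul_comm,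
        ← Matrix.SpecialLinearGroup.coe_mul, mul_inv_cancel_left, trace_T_pow_mul_S,
        Int.natAbs_natCast]

end FullTraceSet

/-- There are infinitely many finite-index subgroups of `SL(2, ℤ)` whose absolute trace set
is all of `ℕ`. -/
theorem infinite_finite_index_subgroups_with_full_trace_set :
    {K : Subgroup SL(2, ℤ) | K.FiniteIndex ∧ absTraceSet K = Set.univ}.Infinite := by
  choose K hK htr using fun n : ℕ => FullTraceSet.exists_full_trace_set_of_index (n + 1)
  refine Set.infinite_of_injective_forall_mem (f := K) (fun m n h => ?_)
    fun n => ⟨⟨by rw [hK]; positivity⟩, htr n⟩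
  have := hK m
  rw [h, hK n] at this
  omega
end

section
/- Let G₀, G₁, G₂ be the subgroups of SL(2,ℤ) generated respectively by the pairs {[[0,-1],[1,0]], [[1,5],[0,1]]}, {[[1,-1],[1,0]], [[1,5],[0,1]]}, and {[[2,-1],[1,0]], [[1,5],[0,1]]}. Then each Gᵢ has infinite index in SL(2,ℤ), and the union of their absolute trace sets equals all of ℕ: {|tr γ| : γ ∈ G₀} ∪ {|tr γ| : γ ∈ G₁} ∪ {|tr γ| : γ ∈ G₂} = ℕ. -/
open scoped MatrixGroups

def u : SL(2, ℤ) := ⟨!![1, 5; 0, 1], by norm_num [Matrix.det_fin_two_of]⟩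
def g₀ : SL(2, ℤ) := ⟨!![0, -1; 1, 0], by norm_num [Matrix.det_fin_two_of]⟩
def g₁ : SL(2, ℤ) := ⟨!![1, -1; 1, 0], by norm_num [Matrix.det_fin_two_of]⟩
def g₂ : SL(2, ℤ) := ⟨!![2, -1; 1, 0], by norm_num [Matrix.det_fin_two_of]⟩

def G₀ : Subgroup SL(2, ℤ) := Subgroup.closure {g₀, u}
def G₁ : Subgroup SL(2, ℤ) := Subgroup.closure {g₁, u}
def G₂ : Subgroup SL(2, ℤ) := Subgroup.closure {g₂, u}

/-- The slope `p / q` of the first column `(p, q)` lies in `[-1, 3]`. -/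
def SlopeInside (M : SL(2, ℤ)) : Prop := (M 0 0 - M 1 0) ^ 2 ≤ 4 * M 1 0 ^ 2

/-- The slope `p / q` of the first column `(p, q)` lies outside `(-1, 3)`. -/
def SlopeOutside (M : SL(2, ℤ)) : Prop := 4 * M 1 0 ^ 2 ≤ (M 0 0 - M 1 0) ^ 2

/-- `γ` is trivial in `PSL(2, ℤ)`, or it moves the outside of `(-1, 3)` into `[-1, 3]`. -/
def IsPingPong (γ : SL(2, ℤ)) : Prop :=
  (γ = 1 ∨ γ = -1) ∨ ∀ M, SlopeOutside M → SlopeInside (γ * M)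

/-- Products of an upper triangular matrix by alternating powers of `g` and `u`; the Boolean
is `true` when the leftmost factor is a power of `g`. -/
inductive AlternatingWord (g : SL(2, ℤ)) : Bool → SL(2, ℤ) → Prop
  | base (M : SL(2, ℤ)) (hM : M 1 0 = 0) : AlternatingWord g false M
  | left (k : ℤ) (M : SL(2, ℤ)) (hk : ∀ N, SlopeOutside N → SlopeInside (g ^ k * N))
      (hM : AlternatingWord g false M) : AlternatingWord g true (g ^ k * M)
  | right (n : ℤ) (M : SL(2, ℤ)) (hn : n ≠ 0) (hM : AlternatingWord g true M) :
      AlternatingWord g false (u ^ n * M)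

theorem coe_u_zpow (n : ℤ) : ((u ^ n : SL(2, ℤ)) : Matrix (Fin 2) (Fin 2) ℤ) =
    !![1, 5 * n; 0, 1] := by
  induction n using Int.induction_on with
  | zero => simp [Matrix.one_fin_two]
  | succ n ih =>
    rw [zpow_add_one, Matrix.SpecialLinearGroup.coe_mul, ih]
    ext i j; fin_cases i <;> fin_cases j <;> simp [u, Matrix.mul_apply, Fin.sum_univ_two]; ring
  | pred n ih =>
    rw [zpow_sub_one, Matrix.SpecialLinearGroup.coe_mul, ih, Matrix.SpecialLinearGroup.coe_inv]
    ext i j; fin_cases i <;> fin_cases j <;>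
      simp [u, Matrix.mul_apply, Fin.sum_univ_two, Matrix.adjugate_fin_two]; ring

theorem coe_g₂_zpow (n : ℤ) :
    ((g₂ ^ n : SL(2, ℤ)) : Matrix (Fin 2) (Fin 2) ℤ) = !![1 + n, -n; n, 1 - n] := by
  induction n using Int.induction_on with
  | zero => simp [Matrix.one_fin_two]
  | succ n ih =>
    rw [zpow_add_one, Matrix.SpecialLinearGroup.coe_mul, ih]
    ext i j; fin_cases i <;> fin_cases j <;>
      simp [g₂, Matrix.mul_apply, Fin.sum_univ_two] <;> ring
  | pred n ih =>
    rw [zpow_sub_one, Matrix.SpecialLinearGroup.coe_mul, ih, Matrix.SpecialLinearGroup.coe_inv]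
    ext i j; fin_cases i <;> fin_cases j <;>
      simp [g₂, Matrix.mul_apply, Fin.sum_univ_two, Matrix.adjugate_fin_two] <;> ring

theorem mul_col_zero (γ M : SL(2, ℤ)) (i : Fin 2) :
    (γ * M) i 0 = γ i 0 * M 0 0 + γ i 1 * M 1 0 := by
  simp [Matrix.mul_apply, Fin.sum_univ_two]

theorem u_zpow_mul_apply_zero (n : ℤ) (M : SL(2, ℤ)) :
    (u ^ n * M) 0 0 = M 0 0 + 5 * n * M 1 0 := by
  rw [mul_col_zero, coe_u_zpow]; simp

theorem u_zpow_mul_apply_one (n : ℤ) (M : SL(2, ℤ)) : (u ^ n * M) 1 0 = M 1 0 := by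
  rw [mul_col_zero, coe_u_zpow]; simp

theorem sq_le_four_sq_iff (a b : ℤ) : a ^ 2 ≤ 4 * b ^ 2 ↔ |a| ≤ 2 * |b| := by
  rw [← sq_abs a, ← sq_abs b, show 4 * |b| ^ 2 = (2 * |b|) ^ 2 by ring]
  exact pow_le_pow_iff_left₀ (abs_nonneg a) (by positivity) two_ne_zero

theorem four_sq_le_sq_iff (a b : ℤ) : 4 * b ^ 2 ≤ a ^ 2 ↔ 2 * |b| ≤ |a| := by
  rw [← sq_abs a, ← sq_abs b, show 4 * |b| ^ 2 = (2 * |b|) ^ 2 by ring]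
  exact pow_le_pow_iff_left₀ (by positivity) (abs_nonneg a) two_ne_zero

theorem abs_le_abs_mul {n : ℤ} (hn : n ≠ 0) (a : ℤ) : |a| ≤ |n * a| := by
  rw [abs_mul]
  exact le_mul_of_one_le_left (abs_nonneg a) (Int.one_le_abs hn)

theorem SlopeInside.u_zpow_mul {M : SL(2, ℤ)} (hM : SlopeInside M) {n : ℤ} (hn : n ≠ 0) :
    SlopeOutside (u ^ n * M) := by
  unfold SlopeInside at hM
  unfold SlopeOutside
  rw [u_zpow_mul_apply_zero, u_zpow_mul_apply_one, four_sq_le_sq_iff]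
  rw [sq_le_four_sq_iff] at hM
  have h := abs_le_abs_mul hn (M 1 0)
  rw [show M 0 0 + 5 * n * M 1 0 - M 1 0 = (M 0 0 - M 1 0) + 5 * (n * M 1 0) by ring]
  grind

theorem SlopeInside.neg {M : SL(2, ℤ)} (hM : SlopeInside M) : SlopeInside (-M) := by
  unfold SlopeInside at *
  simp only [Matrix.SpecialLinearGroup.coe_neg, Matrix.neg_apply]
  linarith

theorem IsPingPong.neg {γ : SL(2, ℤ)} (h : IsPingPong γ) : IsPingPong (-γ) := by
  rcases h with (rfl | rfl) | h
  · exact .inl (.inr rfl)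
  · exact .inl (.inl (neg_neg 1))
  · exact .inr fun M hM => by rw [neg_mul]; exact (h M hM).neg

theorem isPingPong_g₀ : IsPingPong g₀ := by
  refine .inr fun M hM => ?_
  unfold SlopeOutside at hM
  unfold SlopeInside
  rw [four_sq_le_sq_iff] at hM
  rw [sq_le_four_sq_iff, mul_col_zero, mul_col_zero]
  simp only [g₀, Matrix.of_apply, Matrix.cons_val', Matrix.cons_val_zero, Matrix.cons_val_one,
    Matrix.cons_val_fin_one]
  grind

theorem isPingPong_g₁ : IsPingPong g₁ := by
  refine .inr fun M hM => ?_
  unfold SlopeOutside at hM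
  unfold SlopeInside
  rw [four_sq_le_sq_iff] at hM
  rw [sq_le_four_sq_iff, mul_col_zero, mul_col_zero]
  simp only [g₁, Matrix.of_apply, Matrix.cons_val', Matrix.cons_val_zero, Matrix.cons_val_one,
    Matrix.cons_val_fin_one]
  grind

theorem isPingPong_g₁_sq : IsPingPong (g₁ ^ 2) := by
  refine .inr fun M hM => ?_
  unfold SlopeOutside at hM
  unfold SlopeInside
  rw [four_sq_le_sq_iff] at hM
  have hg : ((g₁ ^ 2 : SL(2, ℤ)) : Matrix (Fin 2) (Fin 2) ℤ) = !![0, -1; 1, -1] := by decide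
  rw [sq_le_four_sq_iff, mul_col_zero, mul_col_zero, hg]
  simp only [Matrix.of_apply, Matrix.cons_val', Matrix.cons_val_zero, Matrix.cons_val_one,
    Matrix.cons_val_fin_one]
  grind

/-- If `g ^ m = -1`, then the powers of `g` are, up to sign, those with exponent below `m`. -/
theorem isPingPong_zpow_of_pow_eq_neg_one {g : SL(2, ℤ)} {m : ℕ} (hm : 0 < m)
    (hg : g ^ m = -1) (h : ∀ r < m, IsPingPong (g ^ r)) (k : ℤ) : IsPingPong (g ^ k) := by
  have hr : IsPingPong (g ^ (k % m)) := by
    obtain ⟨r, hr⟩ := Int.eq_ofNat_of_zero_le (Int.emod_nonneg k (by omega : (m : ℤ) ≠ 0))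
    have := Int.emod_lt_of_pos k (by omega : (0 : ℤ) < m)
    rw [hr, zpow_natCast]
    exact h r (by omega)
  rw [← Int.emod_add_mul_ediv k m, zpow_add, zpow_mul, zpow_natCast, hg]
  rcases Int.even_or_odd' (k / m) with ⟨j, hj | hj⟩
  · rw [hj, zpow_mul]
    simpa using hr
  · rw [hj, zpow_add, zpow_mul]
    simpa using hr.neg

theorem isPingPong_g₀_zpow (k : ℤ) : IsPingPong (g₀ ^ k) := by
  refine isPingPong_zpow_of_pow_eq_neg_one (m := 2) two_pos (by decide) (fun r hr => ?_) k
  interval_cases r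
  · exact .inl (.inl (pow_zero _))
  · simpa using isPingPong_g₀

theorem isPingPong_g₁_zpow (k : ℤ) : IsPingPong (g₁ ^ k) := by
  refine isPingPong_zpow_of_pow_eq_neg_one (m := 3) three_pos (by decide) (fun r hr => ?_) k
  interval_cases r
  · exact .inl (.inl (pow_zero _))
  · simpa using isPingPong_g₁
  · exact isPingPong_g₁_sq

theorem isPingPong_g₂_zpow (k : ℤ) : IsPingPong (g₂ ^ k) := by
  rcases eq_or_ne k 0 with rfl | hk
  · exact .inl (.inl (zpow_zero _))
  refine .inr fun M hM => ?_
  unfold SlopeOutside at hM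
  unfold SlopeInside
  rw [four_sq_le_sq_iff] at hM
  rw [sq_le_four_sq_iff, mul_col_zero, mul_col_zero, coe_g₂_zpow]
  simp only [Matrix.of_apply, Matrix.cons_val', Matrix.cons_val_zero, Matrix.cons_val_one,
    Matrix.cons_val_fin_one]
  have h := abs_le_abs_mul hk (M 0 0 - M 1 0)
  rw [show (1 + k) * M 0 0 + -k * M 1 0 - (k * M 0 0 + (1 - k) * M 1 0) = M 0 0 - M 1 0 by ring,
    show k * M 0 0 + (1 - k) * M 1 0 = M 1 0 + k * (M 0 0 - M 1 0) by ring]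
  grind

namespace AlternatingWord

variable {g : SL(2, ℤ)} {b : Bool} {M : SL(2, ℤ)}

theorem neg (h : AlternatingWord g b M) : AlternatingWord g b (-M) := by
  induction h with
  | base M hM => exact .base _ (by simpa using hM)
  | left k M hk _ ih => rw [← mul_neg]; exact .left k _ hk ih
  | right n M hn _ ih => rw [← mul_neg]; exact .right n _ hn ih

theorem slope (h : AlternatingWord g b M) :
    if b then SlopeInside M else SlopeOutside M := by
  induction h with
  | base M hM => simp [SlopeOutside, hM, sq_nonneg]
  | left k M hk _ ih => exact hk _ ih
  | right n M hn _ ih => exact SlopeInside.u_zpow_mul ih hn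

/-- The slope of an alternating word is infinite or in a translate of `[-1, 3]` by `5ℤ`. -/
theorem exists_slopeInside (h : AlternatingWord g b M) :
    M 1 0 = 0 ∨ ∃ n : ℤ, SlopeInside (u ^ n * M) := by
  cases h with
  | base M hM => exact .inl hM
  | left k M hk hM => exact .inr ⟨0, by simpa using hk _ hM.slope⟩
  | right n M hn hM => exact .inr ⟨-n, by simpa using hM.slope⟩

theorem g_zpow_mul (hg : ∀ k : ℤ, IsPingPong (g ^ k)) (h : AlternatingWord g b M) (k : ℤ) :
    ∃ c, AlternatingWord g c (g ^ k * M) := by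
  have outside {N : SL(2, ℤ)} (hN : AlternatingWord g false N) (j : ℤ) :
      ∃ c, AlternatingWord g c (g ^ j * N) := by
    rcases hg j with (hj | hj) | hj
    · exact ⟨false, by simpa [hj] using hN⟩
    · exact ⟨false, by simpa [hj] using hN.neg⟩
    · exact ⟨true, .left j N hj hN⟩
  cases h with
  | base M hM => exact outside (.base M hM) k
  | left j M hj hM => rw [← mul_assoc, ← zpow_add]; exact outside hM _
  | right n M hn hM => exact outside (.right n M hn hM) k

theorem u_zpow_mul (h : AlternatingWord g b M) (n : ℤ) :
    ∃ c, AlternatingWord g c (u ^ n * M) := by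
  have inside {N : SL(2, ℤ)} (hN : AlternatingWord g true N) (j : ℤ) :
      ∃ c, AlternatingWord g c (u ^ j * N) := by
    rcases eq_or_ne j 0 with rfl | hj
    · exact ⟨true, by simpa using hN⟩
    · exact ⟨false, .right j N hj hN⟩
  cases h with
  | base M hM => exact ⟨false, .base _ (by rw [u_zpow_mul_apply_one, hM])⟩
  | left k M hk hM => exact inside (.left k M hk hM) n
  | right j M hj hM => rw [← mul_assoc, ← zpow_add]; exact inside hM _

theorem of_mem_closure (hg : ∀ k : ℤ, IsPingPong (g ^ k)) {γ : SL(2, ℤ)}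
    (hγ : γ ∈ Subgroup.closure {g, u}) : ∃ c, AlternatingWord g c γ := by
  induction hγ using Subgroup.closure_induction_left with
  | one => exact ⟨false, .base 1 (by simp)⟩
  | mul_left x hx y _ ih =>
    obtain ⟨c, hc⟩ := ih
    rcases hx with rfl | rfl
    · simpa using hc.g_zpow_mul hg 1
    · simpa using hc.u_zpow_mul 1
  | inv_mul_cancel x hx y _ ih =>
    obtain ⟨c, hc⟩ := ih
    rcases hx with rfl | rfl
    · simpa using hc.g_zpow_mul hg (-1)
    · simpa using hc.u_zpow_mul (-1)

end AlternatingWord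

/-- A parabolic matrix fixing the slope `7 / 2`. -/
def parabolicFixingSevenHalves : SL(2, ℤ) :=
  ⟨!![15, -49; 4, -13], by norm_num [Matrix.det_fin_two_of]⟩

theorem coe_parabolicFixingSevenHalves_pow (n : ℕ) :
    ((parabolicFixingSevenHalves ^ n : SL(2, ℤ)) : Matrix (Fin 2) (Fin 2) ℤ) =
      !![1 + 14 * (n : ℤ), -49 * n; 4 * n, 1 - 14 * n] := by
  induction n with
  | zero => simp [Matrix.one_fin_two]
  | succ n ih =>
    rw [pow_succ, Matrix.SpecialLinearGroup.coe_mul, ih]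
    ext i j; fin_cases i <;> fin_cases j <;>
      simp [parabolicFixingSevenHalves, Matrix.mul_apply, Fin.sum_univ_two] <;> ring

theorem index_closure_eq_zero {g : SL(2, ℤ)} (hg : ∀ k : ℤ, IsPingPong (g ^ k)) :
    (Subgroup.closure {g, u}).index = 0 := by
  by_contra h
  obtain ⟨m, hm, -, hmem⟩ :=
    Subgroup.exists_pow_mem_of_index_ne_zero h parabolicFixingSevenHalves
  obtain ⟨c, hc⟩ := AlternatingWord.of_mem_closure hg hmem
  have hm' : (0 : ℤ) < m := by exact_mod_cast hm
  rcases hc.exists_slopeInside with h0 | ⟨n, hn⟩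
  · rw [coe_parabolicFixingSevenHalves_pow] at h0
    simp at h0
    omega
  · unfold SlopeInside at hn
    rw [u_zpow_mul_apply_zero, u_zpow_mul_apply_one, coe_parabolicFixingSevenHalves_pow,
      sq_le_four_sq_iff] at hn
    simp only [Matrix.of_apply, Matrix.cons_val', Matrix.cons_val_zero, Matrix.cons_val_one,
      Matrix.cons_val_fin_one] at hn
    rw [abs_of_pos (by omega : (0 : ℤ) < 4 * m), abs_le] at hn
    obtain ⟨h1, h2⟩ := hn
    rcases le_or_gt 0 n with hn | hn
    · nlinarith
    · have : (m : ℤ) * n ≤ -m := by nlinarith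
      nlinarith

theorem natAbs_trace_add_mem_absTraceSet {g : SL(2, ℤ)} {t : ℤ} (ht : g 0 0 + g 1 1 = t)
    (hg : g 1 0 = 1) (n : ℤ) : (t + 5 * n).natAbs ∈ absTraceSet (Subgroup.closure {g, u}) := by
  refine ⟨g * u ^ n, mul_mem (Subgroup.subset_closure (by simp))
    (zpow_mem (Subgroup.subset_closure (by simp)) n), ?_⟩
  rw [Matrix.SpecialLinearGroup.coe_mul, coe_u_zpow, Matrix.trace_fin_two]
  congr 1
  simp [Matrix.mul_apply, Fin.sum_univ_two, hg, ← ht]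
  ring

/-- Each of the groups `G₀`, `G₁`, `G₂` has infinite index in `SL(2, ℤ)`, and the union of
their absolute trace sets is all of `ℕ`. -/
theorem three_subgroups_infinite_index_union_trace_sets :
    G₀.index = 0 ∧ G₁.index = 0 ∧ G₂.index = 0 ∧
      absTraceSet G₀ ∪ absTraceSet G₁ ∪ absTraceSet G₂ = Set.univ := by
  refine ⟨index_closure_eq_zero isPingPong_g₀_zpow, index_closure_eq_zero isPingPong_g₁_zpow,
    index_closure_eq_zero isPingPong_g₂_zpow, Set.eq_univ_of_forall fun n => ?_⟩
  have h₀ (k : ℤ) : (0 + 5 * k).natAbs ∈ absTraceSet G₀ :=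
    natAbs_trace_add_mem_absTraceSet (by decide) (by decide) k
  have h₁ (k : ℤ) : (1 + 5 * k).natAbs ∈ absTraceSet G₁ :=
    natAbs_trace_add_mem_absTraceSet (by decide) (by decide) k
  have h₂ (k : ℤ) : (2 + 5 * k).natAbs ∈ absTraceSet G₂ :=
    natAbs_trace_add_mem_absTraceSet (by decide) (by decide) k
  obtain ⟨k, hk | hk | hk | hk | hk⟩ : ∃ k : ℤ, n = 5 * k ∨ n = 1 + 5 * k ∨ n = 2 + 5 * k ∨
      n = -(2 + 5 * k) ∨ n = -(1 + 5 * k) := by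
    have : n % 5 < 5 := Nat.mod_lt _ (by norm_num)
    by_cases h : n % 5 < 3
    · exact ⟨n / 5, by omega⟩
    · exact ⟨-(n / 5) - 1, by omega⟩
  · exact .inl (.inl (by convert h₀ k; omega))
  · exact .inl (.inr (by convert h₁ k; omega))
  · exact .inr (by convert h₂ k; omega)
  · exact .inr (by convert h₂ k; omega)
  · exact .inl (.inr (by convert h₁ k; omega))
end

section
/- For every positive integer n, the trace set of the congruence subgroup Γ₀(n) ≤ SL(2,ℤ) equals the set of integers t such that the reduction of t modulo n can be written as a + a⁻¹ for some unit a of ℤ/nℤ; that is, {tr γ : γ ∈ Γ₀(n)} = {t ∈ ℤ : ∃ a ∈ (ℤ/nℤ)ˣ, (t mod n) = a + a⁻¹}. -/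
open scoped MatrixGroups

/-- The trace set of a subgroup of `SL(2, ℤ)`, as a set of integers. -/
def traceSet (H : Subgroup SL(2, ℤ)) : Set ℤ :=
  {t : ℤ | ∃ γ ∈ H, Matrix.trace (γ : Matrix (Fin 2) (Fin 2) ℤ) = t}

/-- The trace set of `Γ₀(n)` consists exactly of the integers whose reduction modulo `n`
has the form `a + a⁻¹` for a unit `a` of `ℤ/nℤ`. -/
theorem traceSet_Gamma0 (n : ℕ) (hn : 0 < n) :
    traceSet (CongruenceSubgroup.Gamma0 n) =
      {t : ℤ | ∃ a : (ZMod n)ˣ, (t : ZMod n) = (a : ZMod n) + ((a⁻¹ : (ZMod n)ˣ) : ZMod n)} := by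
  ext t
  constructor
  · rintro ⟨γ, hγ, rfl⟩
    have hc : ((γ 1 0 : ℤ) : ZMod n) = 0 := CongruenceSubgroup.Gamma0_mem.mp hγ
    have hdet : γ 0 0 * γ 1 1 - γ 0 1 * γ 1 0 = 1 := by
      rw [← Matrix.det_fin_two]
      exact γ.det_coe
    have hunit : ((γ 0 0 : ℤ) : ZMod n) * ((γ 1 1 : ℤ) : ZMod n) = 1 := by
      simpa [hc] using congrArg (Int.cast : ℤ → ZMod n) hdet
    exact ⟨⟨_, _, hunit, by rwa [mul_comm]⟩, by simp [Matrix.trace_fin_two]⟩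
  · rintro ⟨a, ha⟩
    obtain ⟨x, hx⟩ := ZMod.intCast_surjective (a : ZMod n)
    have hdvd : (n : ℤ) ∣ x * (t - x) - 1 := by
      rw [← ZMod.intCast_zmod_eq_zero_iff_dvd]
      simp [ha, hx]
    obtain ⟨k, hk⟩ := hdvd
    have hdet : Matrix.det !![x, k; (n : ℤ), t - x] = 1 := by
      rw [Matrix.det_fin_two_of]
      linarith
    let γ : SL(2, ℤ) := ⟨!![x, k; (n : ℤ), t - x], hdet⟩
    have hγ : γ ∈ CongruenceSubgroup.Gamma0 n :=
      CongruenceSubgroup.Gamma0_mem.mpr (by simp [γ])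
    exact ⟨γ, hγ, by simp [γ, Matrix.trace_fin_two]⟩
end

section
/- For every positive integer n, the trace set of the principal congruence subgroup Γ(n) ≤ SL(2,ℤ) equals the set of integers congruent to 2 modulo n²; that is, {tr γ : γ ∈ Γ(n)} = {t ∈ ℤ : t ≡ 2 (mod n²)}. -/
open scoped MatrixGroups

/-- The trace set of the principal congruence subgroup `Γ(n)` is the set of integers
congruent to `2` modulo `n²`. -/
theorem traceSet_Gamma (n : ℕ) (hn : 0 < n) :
    traceSet (CongruenceSubgroup.Gamma n) = {t : ℤ | t ≡ 2 [ZMOD (n : ℤ) ^ 2]} := by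
  ext t
  simp only [traceSet, Set.mem_ofPred_eq, CongruenceSubgroup.Gamma_mem, Matrix.trace_fin_two]
  constructor
  · rintro ⟨γ, ⟨ha, hb, hc, hd⟩, rfl⟩
    have : NeZero n := ⟨hn.ne'⟩
    have hdet := γ.det_coe
    rw [Matrix.det_fin_two] at hdet
    have ha' : (n : ℤ) ∣ γ 0 0 - 1 := by
      simp [← ZMod.intCast_zmod_eq_zero_iff_dvd, ha]
    have hd' : (n : ℤ) ∣ γ 1 1 - 1 := by
      simp [← ZMod.intCast_zmod_eq_zero_iff_dvd, hd]
    obtain ⟨x, hx⟩ := ha'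
    obtain ⟨w, hw⟩ := hd'
    obtain ⟨y, hy⟩ := (ZMod.intCast_zmod_eq_zero_iff_dvd _ n).1 hb
    obtain ⟨z, hz⟩ := (ZMod.intCast_zmod_eq_zero_iff_dvd _ n).1 hc
    refine (Int.modEq_iff_dvd.2 ⟨y * z - x * w, ?_⟩).symm
    grind
  · intro h
    obtain ⟨k, hk⟩ := Int.modEq_iff_dvd.1 h.symm
    refine ⟨⟨!![1 + n ^ 2 * k, n; n * k, 1], ?_⟩, ?_, ?_⟩
    · rw [Matrix.det_fin_two_of]
      ring
    · simp
    · simp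
      linarith
end

section
/- For every positive integer n, there exists a finitely generated subgroup H of the congruence subgroup Γ₀(n) ≤ SL(2,ℤ) such that H has infinite index in SL(2,ℤ) and {tr γ : γ ∈ H} = {tr γ : γ ∈ Γ₀(n)}. -/
open scoped MatrixGroups

section PingPong

variable {G : Type*} [Group G]

/-- Every element of `H` outside `Z` translates the set `J` off itself. -/
def MovesOff (Z H : Subgroup G) (J : Set G) : Prop :=
  ∀ h ∈ H, h ∉ Z → ∀ g ∈ J, h * g ∉ J

theorem MovesOff.mono {Z H : Subgroup G} {J J' : Set G} (h : MovesOff Z H J) (hJ : J' ⊆ J) :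
    MovesOff Z H J' :=
  fun a ha haZ g hg hag => h a ha haZ g (hJ hg) (hJ hag)

theorem MovesOff.conj {Z H : Subgroup G} [Z.Normal] {J : Set G} (h : MovesOff Z H J) (s : G) :
    MovesOff Z (H.map (MulAut.conj s).toMonoidHom) {g | s⁻¹ * g ∈ J} := by
  rintro _ ⟨a, ha, rfl⟩ haZ g hg hag
  refine h a ha (fun haZ' => haZ ?_) _ hg ?_
  · simpa using Subgroup.Normal.conj_mem inferInstance a haZ' s
  · simpa [mul_assoc] using hag

/-- The reduced products of elements of `H i` and `H !i` outside `Z`, with first letter in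
`H i`. -/
inductive ReducedProduct (Z : Subgroup G) (H : Bool → Subgroup G) : Bool → G → Prop
  | single {i : Bool} {a : G} (ha : a ∈ H i) (haZ : a ∉ Z) : ReducedProduct Z H i a
  | cons {i : Bool} {a w : G} (ha : a ∈ H i) (haZ : a ∉ Z) (hw : ReducedProduct Z H (!i) w) :
      ReducedProduct Z H i (a * w)

namespace ReducedProduct

variable {Z : Subgroup G} {H : Bool → Subgroup G}

theorem central_mul (hZ : ∀ i, Z ≤ H i) {i : Bool} {z w : G} (hz : z ∈ Z)
    (hw : ReducedProduct Z H i w) : ReducedProduct Z H i (z * w) := by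
  cases hw with
  | single ha haZ =>
    exact .single (mul_mem (hZ i hz) ha) (by rwa [Subgroup.mul_mem_cancel_left _ hz])
  | cons ha haZ hw =>
    rw [← mul_assoc]
    exact .cons (mul_mem (hZ i hz) ha) (by rwa [Subgroup.mul_mem_cancel_left _ hz]) hw

theorem mul_left (hZ : ∀ i, Z ≤ H i) {j : Bool} {b w : G} (hb : b ∈ H j)
    (hw : w ∈ Z ∨ ∃ i, ReducedProduct Z H i w) :
    b * w ∈ Z ∨ ∃ i, ReducedProduct Z H i (b * w) := by
  by_cases hbZ : b ∈ Z
  · rcases hw with hw | ⟨i, hw⟩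
    · exact .inl (mul_mem hbZ hw)
    · exact .inr ⟨i, hw.central_mul hZ hbZ⟩
  rcases hw with hw | ⟨i, hw⟩
  · exact .inr ⟨j, .single (mul_mem hb (hZ j hw)) (by rwa [Subgroup.mul_mem_cancel_right _ hw])⟩
  by_cases hij : i = !j
  · subst hij
    exact .inr ⟨j, .cons hb hbZ hw⟩
  obtain rfl : i = j := by simpa using hij
  cases hw with
  | single ha haZ =>
    by_cases h : b * w ∈ Z
    · exact .inl h
    · exact .inr ⟨i, .single (mul_mem hb ha) h⟩
  | @cons _ a w ha haZ hw =>
    rw [← mul_assoc]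
    by_cases h : b * a ∈ Z
    · exact .inr ⟨_, hw.central_mul hZ h⟩
    · exact .inr ⟨i, .cons (mul_mem hb ha) h hw⟩

theorem mul_notMem {J : Bool → Set G} (hJ : ∀ i g, g ∉ J i → g ∈ J (!i))
    (h : ∀ i, MovesOff Z (H i) (J i)) {i : Bool} {w g : G} (hw : ReducedProduct Z H i w)
    (hg : ∀ i, g ∈ J i) : w * g ∉ J i := by
  induction hw with
  | @single i a ha haZ => exact h i a ha haZ g (hg i)
  | @cons i a w ha haZ hw ih =>
    rw [mul_assoc]
    exact h i a ha haZ _ (by simpa using hJ _ _ ih)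

end ReducedProduct

theorem MovesOff.sup {Z H₁ H₂ : Subgroup G} {J₁ J₂ : Set G} (hZ₁ : Z ≤ H₁) (hZ₂ : Z ≤ H₂)
    (h₁ : MovesOff Z H₁ J₁) (h₂ : MovesOff Z H₂ J₂) (hJ : J₁ ∪ J₂ = Set.univ) :
    MovesOff Z (H₁ ⊔ H₂) (J₁ ∩ J₂) := by
  set H : Bool → Subgroup G := fun i => cond i H₁ H₂
  set J : Bool → Set G := fun i => cond i J₁ J₂ with hJ'
  have hZ : ∀ i, Z ≤ H i := by rintro (_ | _) <;> assumption
  have hm : ∀ i, MovesOff Z (H i) (J i) := by rintro (_ | _) <;> assumption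
  have hc : ∀ i g, g ∉ J i → g ∈ J (!i) := by
    intro i g
    have : g ∈ J₁ ∪ J₂ := hJ ▸ Set.mem_univ g
    rcases i with _ | _ <;> simp only [hJ', cond_true, cond_false, Bool.not_true, Bool.not_false]
      <;> simp only [Set.mem_union] at this <;> tauto
  have key : ∀ a ∈ H₁ ⊔ H₂, a ∈ Z ∨ ∃ i, ReducedProduct Z H i a := by
    intro a ha
    rw [Subgroup.sup_eq_closure] at ha
    induction ha using Subgroup.closure_induction_left with
    | one => exact .inl (one_mem _)
    | mul_left x hx y _ ih =>
      rcases hx with hx | hx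
      · exact ReducedProduct.mul_left hZ (j := true) hx ih
      · exact ReducedProduct.mul_left hZ (j := false) hx ih
    | inv_mul_cancel x hx y _ ih =>
      rcases hx with hx | hx
      · exact ReducedProduct.mul_left hZ (j := true) (inv_mem hx) ih
      · exact ReducedProduct.mul_left hZ (j := false) (inv_mem hx) ih
  rintro a ha haZ g ⟨hg₁, hg₂⟩ ⟨hag₁, hag₂⟩
  obtain ⟨i, hi⟩ := (key a ha).resolve_left haZ
  refine hi.mul_notMem (g := g) hc hm (by rintro (_ | _) <;> assumption) ?_
  rcases i with _ | _ <;> assumption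

end PingPong

theorem Subgroup.FG.map_monoidHom {G G' : Type*} [Group G] [Group G'] {H : Subgroup G}
    (hH : H.FG) (f : G →* G') : (H.map f).FG := by
  rw [Subgroup.fg_iff_submonoid_fg] at hH ⊢
  exact hH.map f

open ModularGroup Matrix

/-- The subgroup `{1, -1}` of `SL(2, ℤ)`. -/
def signs : Subgroup SL(2, ℤ) := Subgroup.zpowers (-1)

theorem mem_signs {g : SL(2, ℤ)} : g ∈ signs ↔ g = 1 ∨ g = -1 := by
  constructor
  · rintro ⟨k, rfl⟩
    rcases Int.even_or_odd k with h | h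
    · exact .inl h.neg_one_zpow
    · exact .inr h.neg_one_zpow
  · rintro (rfl | rfl)
    · exact one_mem _
    · exact Subgroup.mem_zpowers _

instance signs_normal : signs.Normal :=
  ⟨fun a ha g => by rcases mem_signs.1 ha with rfl | rfl <;> simp [mem_signs]⟩

/-- The elements `g` such that `|g ∞| > R`. -/
def nearInfinity (R : ℤ) : Set SL(2, ℤ) := {g | R * |g 1 0| < |g 0 0|}

theorem col_ne_zero (g : SL(2, ℤ)) (h0 : g 0 0 = 0) (h1 : g 1 0 = 0) : False := by
  have := g.det_coe
  rw [Matrix.det_fin_two] at this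
  simp [h0, h1] at this

theorem T_zpow_mul_apply_zero (k : ℤ) (g : SL(2, ℤ)) :
    (T ^ k * g) 0 0 = g 0 0 + k * g 1 0 := by
  simp only [Matrix.SpecialLinearGroup.coe_mul, coe_T_zpow]
  simp [Matrix.mul_apply, Fin.sum_univ_two]

theorem T_zpow_mul_apply_one (k : ℤ) (g : SL(2, ℤ)) : (T ^ k * g) 1 0 = g 1 0 := by
  simp only [Matrix.SpecialLinearGroup.coe_mul, coe_T_zpow]
  simp [Matrix.mul_apply, Fin.sum_univ_two]

theorem T_zpow_notMem_signs {k : ℤ} (hk : k ≠ 0) : T ^ k ∉ signs := by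
  rw [mem_signs]
  rintro (h | h)
  · have := congrArg (fun g : SL(2, ℤ) => (g : Matrix (Fin 2) (Fin 2) ℤ) 0 1) h
    simp only [coe_T_zpow] at this
    simp [hk] at this
  · have := congrArg (fun g : SL(2, ℤ) => (g : Matrix (Fin 2) (Fin 2) ℤ) 0 1) h
    simp only [coe_T_zpow] at this
    simp [hk] at this

/-- A finitely generated subgroup of `Γ₀(n)` containing `-1` all of whose elements other than
`±1` move some neighbourhood of `∞` off itself. -/
structure IsThin (n : ℕ) (H : Subgroup SL(2, ℤ)) : Prop where
  le : H ≤ CongruenceSubgroup.Gamma0 n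
  fg : H.FG
  signs_le : signs ≤ H
  movesOff : ∃ R : ℤ, MovesOff signs H (nearInfinity R)

theorem nearInfinity_anti {R R' : ℤ} (h : R ≤ R') : nearInfinity R' ⊆ nearInfinity R := by
  intro g hg
  have := mul_le_mul_of_nonneg_right h (abs_nonneg (g 1 0))
  exact lt_of_le_of_lt this hg

theorem IsThin.index_eq_zero {n : ℕ} {H : Subgroup SL(2, ℤ)} (h : IsThin n H) : H.index = 0 := by
  by_contra hi
  obtain ⟨k, hk, -, hkH⟩ := Subgroup.exists_pow_mem_of_index_ne_zero hi T
  obtain ⟨R, hR⟩ := h.movesOff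
  have hk' : (T ^ (k : ℤ) : SL(2, ℤ)) = T ^ k := zpow_natCast _ _
  rw [← hk'] at hkH
  refine hR _ hkH ?_ 1 ?_ ?_
  · exact T_zpow_notMem_signs (by omega)
  · simp [nearInfinity]
  · simp [nearInfinity, T_zpow_mul_apply_zero, T_zpow_mul_apply_one, -zpow_natCast, -mul_one]

theorem mem_traceSet_conj {H : Subgroup SL(2, ℤ)} (s : SL(2, ℤ)) {t : ℤ} (h : t ∈ traceSet H) :
    t ∈ traceSet (H.map (MulAut.conj s).toMonoidHom) := by
  obtain ⟨g, hg, rfl⟩ := h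
  refine ⟨_, Subgroup.mem_map_of_mem _ hg, ?_⟩
  simp only [MulEquiv.toMonoidHom_eq_coe, MonoidHom.coe_coe, MulAut.conj_apply,
    Matrix.SpecialLinearGroup.coe_mul]
  rw [Matrix.trace_mul_comm, ← mul_assoc, ← Matrix.SpecialLinearGroup.coe_mul]
  simp

theorem traceSet_mono {H K : Subgroup SL(2, ℤ)} (h : H ≤ K) : traceSet H ⊆ traceSet K :=
  fun _ ⟨g, hg, ht⟩ => ⟨g, h hg, ht⟩

theorem signs_le_conj {H : Subgroup SL(2, ℤ)} (h : signs ≤ H) (s : SL(2, ℤ)) :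
    signs ≤ H.map (MulAut.conj s).toMonoidHom := fun a ha =>
  ⟨a, h ha, by rcases mem_signs.1 ha with rfl | rfl <;> simp⟩

theorem T_zpow_mem_Gamma0 (n : ℕ) (k : ℤ) : T ^ k ∈ CongruenceSubgroup.Gamma0 n := by
  simp [CongruenceSubgroup.Gamma0_mem, coe_T_zpow]

theorem IsThin.exists_sup {n : ℕ} {H₁ H₂ : Subgroup SL(2, ℤ)} (h₁ : IsThin n H₁)
    (h₂ : IsThin n H₂) :
    ∃ H, IsThin n H ∧ traceSet H₁ ⊆ traceSet H ∧ traceSet H₂ ⊆ traceSet H := by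
  obtain ⟨R₁, hR₁⟩ := h₁.movesOff
  obtain ⟨R₂, hR₂⟩ := h₂.movesOff
  obtain ⟨R, hR, hR0, hR1⟩ : ∃ R : ℤ, 0 < R ∧ R₁ ≤ R ∧ R₂ ≤ R :=
    ⟨max 1 (max R₁ R₂), by simp, by simp, by simp⟩
  set s : SL(2, ℤ) := T ^ (3 * R) with hs
  have hs' : s⁻¹ = T ^ (-(3 * R)) := by rw [hs, _root_.zpow_neg]
  have m₁ := hR₁.mono (nearInfinity_anti hR0)
  have m₂ := (hR₂.mono (nearInfinity_anti hR1)).conj s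
  refine ⟨H₁ ⊔ H₂.map (MulAut.conj s).toMonoidHom,
    ⟨sup_le h₁.le ?_, h₁.fg.sup (h₂.fg.map_monoidHom _), h₁.signs_le.trans le_sup_left, 4 * R, ?_⟩,
    traceSet_mono le_sup_left, fun t ht => traceSet_mono le_sup_right (mem_traceSet_conj s ht)⟩
  · rintro _ ⟨a, ha, rfl⟩
    have := T_zpow_mem_Gamma0 n (3 * R)
    exact mul_mem (mul_mem this (h₂.le ha)) (inv_mem this)
  · refine (m₁.sup h₁.signs_le (signs_le_conj h₂.signs_le s) m₂ ?_).mono ?_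
    · refine Set.eq_univ_of_forall fun g => ?_
      by_contra hg
      simp only [nearInfinity, Set.mem_union, Set.mem_ofPred_eq, hs', T_zpow_mul_apply_zero,
        T_zpow_mul_apply_one, not_or, not_lt] at hg
      obtain ⟨ha, hb⟩ := hg
      have h3 : 3 * R * |g 1 0| ≤ 2 * (R * |g 1 0|) := by
        have e : 3 * R * |g 1 0| = |g 0 0 - (g 0 0 + -(3 * R) * g 1 0)| := by
          rw [← abs_of_pos (by positivity : 0 < 3 * R), ← abs_mul]
          congr 1
          rw [abs_of_pos (by positivity : 0 < 3 * R)]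
          ring
        have := abs_sub (g 0 0) (g 0 0 + -(3 * R) * g 1 0)
        linarith
      have h10 : |g 1 0| = 0 := le_antisymm (by nlinarith) (abs_nonneg _)
      rw [h10] at ha
      exact col_ne_zero g (by simpa using ha) (by simpa using h10)
    · intro g hg
      simp only [nearInfinity, Set.mem_inter_iff, Set.mem_ofPred_eq, hs', T_zpow_mul_apply_zero,
        T_zpow_mul_apply_one] at hg ⊢
      have h0 : 0 ≤ R * |g 1 0| := by positivity
      refine ⟨by linarith, ?_⟩
      have e : |3 * R * g 1 0| = 3 * (R * |g 1 0|) := by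
        rw [abs_mul, abs_of_pos (by positivity : 0 < 3 * R)]; ring
      have := abs_sub_abs_le_abs_sub (g 0 0) (3 * R * g 1 0)
      rw [show g 0 0 + -(3 * R) * g 1 0 = g 0 0 - 3 * R * g 1 0 by ring]
      linarith

theorem isThin_signs (n : ℕ) : IsThin n signs where
  le g hg := by
    rcases mem_signs.1 hg with rfl | rfl <;> simp [CongruenceSubgroup.Gamma0_mem]
  fg := ⟨{-1}, by simp [signs, Subgroup.zpowers_eq_closure]⟩
  signs_le := le_rfl
  movesOff := ⟨0, fun _ h h' => (h' h).elim⟩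

theorem exists_isThin_of_finset {n : ℕ} {ι : Type*} (F : Finset ι) (H : ι → Subgroup SL(2, ℤ))
    (h : ∀ i ∈ F, IsThin n (H i)) :
    ∃ K, IsThin n K ∧ ∀ i ∈ F, traceSet (H i) ⊆ traceSet K := by
  classical
  induction F using Finset.induction_on with
  | empty => exact ⟨signs, isThin_signs n, by simp⟩
  | insert a F _ ih =>
    obtain ⟨K, hK, hKF⟩ := ih fun i hi => h i (Finset.mem_insert_of_mem hi)
    obtain ⟨L, hL, h1, h2⟩ := (h a (Finset.mem_insert_self a F)).exists_sup hK
    refine ⟨L, hL, fun i hi => ?_⟩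
    rcases Finset.mem_insert.1 hi with rfl | hi
    · exact h1
    · exact (hKF i hi).trans h2

/-- The matrix `T ^ t * S`, of trace `t`. -/
def hook (t : ℤ) : SL(2, ℤ) := ⟨!![t, -1; 1, 0], by simp [Matrix.det_fin_two]⟩

theorem hook_mul_apply_zero (t : ℤ) (g : SL(2, ℤ)) :
    (hook t * g) 0 0 = t * g 0 0 - g 1 0 := by
  rw [Matrix.SpecialLinearGroup.coe_mul]
  simp [hook, Matrix.mul_apply, Fin.sum_univ_two]
  ring

theorem hook_mul_apply_one (t : ℤ) (g : SL(2, ℤ)) : (hook t * g) 1 0 = g 0 0 := by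
  rw [Matrix.SpecialLinearGroup.coe_mul]
  simp [hook, Matrix.mul_apply, Fin.sum_univ_two]

theorem hook_inv_mul_apply_zero (t : ℤ) (g : SL(2, ℤ)) : ((hook t)⁻¹ * g) 0 0 = g 1 0 := by
  have := hook_mul_apply_one t ((hook t)⁻¹ * g)
  rw [mul_inv_cancel_left] at this
  exact this.symm

theorem hook_inv_mul_apply_one (t : ℤ) (g : SL(2, ℤ)) :
    ((hook t)⁻¹ * g) 1 0 = t * g 1 0 - g 0 0 := by
  have := hook_mul_apply_zero t ((hook t)⁻¹ * g)
  rw [mul_inv_cancel_left, hook_inv_mul_apply_zero] at this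
  linarith

theorem neg_coe_apply (g : SL(2, ℤ)) (i j : Fin 2) : (-g) i j = -g i j := by
  simp

/-- The elements `g` with `g ∞` outside the interval of length `w` centred at `t / 2`. -/
def outside (t w : ℤ) : Set SL(2, ℤ) := {g | w * |g 1 0| < |2 * g 0 0 - t * g 1 0|}

/-- The elements `g` with `g ∞` inside the interval of length `w` centred at `t / 2`. -/
def inside (t w : ℤ) : Set SL(2, ℤ) := {g | |2 * g 0 0 - t * g 1 0| < w * |g 1 0|}

theorem neg_mem_outside {t w : ℤ} {g : SL(2, ℤ)} : -g ∈ outside t w ↔ g ∈ outside t w := by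
  simp only [outside, Set.mem_ofPred_eq, neg_coe_apply, abs_neg]
  rw [← abs_neg (2 * g 0 0 - t * g 1 0), neg_sub, mul_neg, mul_neg, neg_sub_neg]

theorem neg_mem_inside {t w : ℤ} {g : SL(2, ℤ)} : -g ∈ inside t w ↔ g ∈ inside t w := by
  simp only [inside, Set.mem_ofPred_eq, neg_coe_apply, abs_neg]
  rw [← abs_neg (2 * g 0 0 - t * g 1 0), neg_sub, mul_neg, mul_neg, neg_sub_neg]

theorem mem_zpowers_sup_signs {a g : SL(2, ℤ)} (h : g ∈ Subgroup.zpowers a ⊔ signs) :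
    ∃ k : ℤ, g = a ^ k ∨ g = -a ^ k := by
  obtain ⟨_, ⟨k, rfl⟩, z, hz, rfl⟩ := Subgroup.mem_sup_of_normal_right.1 h
  rcases mem_signs.1 hz with rfl | rfl
  · exact ⟨k, .inl (mul_one _)⟩
  · exact ⟨k, .inr (mul_neg_one _)⟩

theorem movesOff_zpowers_sup_signs {a : SL(2, ℤ)} {J : Set SL(2, ℤ)}
    (hJ : ∀ g, -g ∈ J ↔ g ∈ J) (h : ∀ k : ℤ, a ^ k ∉ signs → ∀ g ∈ J, a ^ k * g ∉ J) :
    MovesOff signs (Subgroup.zpowers a ⊔ signs) J := by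
  intro b hb hbs g hg
  obtain ⟨k, rfl | rfl⟩ := mem_zpowers_sup_signs hb
  · exact h k hbs g hg
  · rw [neg_mul, hJ]
    refine h k (fun hk => hbs ?_) g hg
    rcases mem_signs.1 hk with e | e <;> simp [e, mem_signs]

theorem movesOff_T_zpow {q : ℤ} (hq : 0 < q) (t : ℤ) :
    MovesOff signs (Subgroup.zpowers (T ^ q) ⊔ signs) (inside t q) := by
  refine movesOff_zpowers_sup_signs (fun _ => neg_mem_inside) fun k hk g hg hg' => ?_
  rw [← _root_.zpow_mul] at hk hg'
  have hk0 : k ≠ 0 := by rintro rfl; simp at hk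
  simp only [inside, Set.mem_ofPred_eq, T_zpow_mul_apply_zero, T_zpow_mul_apply_one] at hg hg'
  have h1 : 1 ≤ |k| := Int.one_le_abs hk0
  have e : 2 * (|k| * (q * |g 1 0|)) =
      |(2 * (g 0 0 + q * k * g 1 0) - t * g 1 0) - (2 * g 0 0 - t * g 1 0)| := by
    rw [show (2 * (g 0 0 + q * k * g 1 0) - t * g 1 0) - (2 * g 0 0 - t * g 1 0)
      = 2 * (k * (q * g 1 0)) by ring, abs_mul, abs_mul, abs_mul, abs_of_pos hq]
    norm_num
  have := abs_sub (2 * (g 0 0 + q * k * g 1 0) - t * g 1 0) (2 * g 0 0 - t * g 1 0)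
  have h2 : 0 ≤ q * |g 1 0| := by positivity
  nlinarith

theorem abs_le_of_outside {t : ℤ} (ht : 0 ≤ t) {u v : ℤ} (h : (t + 2) * |v| < |2 * u - t * v|) :
    |v| ≤ |u| ∧ |v| ≤ |t * v - u| := by
  have h1 := abs_sub (2 * u) (t * v)
  have h2 := abs_sub (2 * (t * v - u)) (t * v)
  have e1 : |t * v| = t * |v| := by rw [abs_mul, abs_of_nonneg ht]
  have e2 : |2 * u| = 2 * |u| := by rw [abs_mul]; norm_num
  have e3 : |2 * (t * v - u)| = 2 * |t * v - u| := by rw [abs_mul]; norm_num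
  have e4 : |2 * (t * v - u) - t * v| = |2 * u - t * v| := by
    rw [← abs_neg]; ring_nf
  constructor <;> linarith

theorem hook_zpow_mul_notMem {t : ℤ} (ht : 2 ≤ t) {k : ℤ} (hk : k ≠ 0) {g : SL(2, ℤ)}
    (hg : g ∈ outside t (t + 2)) : hook t ^ k * g ∉ outside t (t + 2) := by
  have hA := abs_le_of_outside (by omega) hg
  have e1 : ∀ v : ℤ, |t * v| = t * |v| := fun v => by rw [abs_mul, abs_of_nonneg (by omega)]
  have e2 : ∀ v : ℤ, |2 * v| = 2 * |v| := fun v => by rw [abs_mul]; norm_num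
  have fwd : ∀ m : ℕ, |(hook t ^ m * g) 1 0| ≤ |(hook t ^ m * g) 0 0| ∧
      (m ≠ 0 → |t * (hook t ^ m * g) 1 0 - (hook t ^ m * g) 0 0| ≤ |(hook t ^ m * g) 1 0|) := by
    intro m
    induction m with
    | zero => simpa using hA.1
    | succ m ih =>
      rw [pow_succ', mul_assoc, hook_mul_apply_zero, hook_mul_apply_one]
      generalize (hook t ^ m * g) 0 0 = u at *
      generalize (hook t ^ m * g) 1 0 = v at *
      have h := abs_sub_abs_le_abs_sub (t * u) v
      rw [e1] at h
      refine ⟨by nlinarith [abs_nonneg u], fun _ => ?_⟩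
      rw [show t * u - (t * u - v) = v by ring]
      exact ih.1
  have bwd : ∀ m : ℕ, |(((hook t)⁻¹) ^ m * g) 1 0| ≤
      |t * (((hook t)⁻¹) ^ m * g) 1 0 - (((hook t)⁻¹) ^ m * g) 0 0| ∧
      (m ≠ 0 → |(((hook t)⁻¹) ^ m * g) 0 0| ≤ |(((hook t)⁻¹) ^ m * g) 1 0|) := by
    intro m
    induction m with
    | zero => simpa using hA.2
    | succ m ih =>
      rw [pow_succ', mul_assoc, hook_inv_mul_apply_zero, hook_inv_mul_apply_one]
      generalize ((hook t)⁻¹ ^ m * g) 0 0 = u at *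
      generalize ((hook t)⁻¹ ^ m * g) 1 0 = v at *
      have h := abs_sub_abs_le_abs_sub (t * (t * v - u)) v
      rw [e1] at h
      exact ⟨by nlinarith [abs_nonneg (t * v - u)], fun _ => ih.1⟩
  simp only [outside, Set.mem_ofPred_eq, not_lt]
  rcases lt_or_gt_of_ne hk with hk | hk
  · obtain ⟨m, rfl⟩ : ∃ m : ℕ, k = -(m : ℤ) := ⟨k.natAbs, by omega⟩
    have h := (bwd m).2 (by omega)
    rw [_root_.zpow_neg, zpow_natCast, ← inv_pow]
    generalize ((hook t)⁻¹ ^ m * g) 0 0 = u at *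
    generalize ((hook t)⁻¹ ^ m * g) 1 0 = v at *
    have := abs_sub (2 * u) (t * v)
    rw [e1, e2] at this
    linarith
  · obtain ⟨m, rfl⟩ : ∃ m : ℕ, k = (m : ℤ) := ⟨k.natAbs, by omega⟩
    have h := (fwd m).2 (by omega)
    rw [zpow_natCast]
    generalize (hook t ^ m * g) 0 0 = u at *
    generalize (hook t ^ m * g) 1 0 = v at *
    have := abs_sub (t * v) (2 * (t * v - u))
    rw [e1, e2, show t * v - 2 * (t * v - u) = 2 * u - t * v by ring] at this
    linarith

theorem hook_zero_sq : hook 0 ^ 2 = -1 := by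
  ext i j
  fin_cases i <;> fin_cases j <;> decide

theorem hook_one_cube : hook 1 ^ 3 = -1 := by
  ext i j
  fin_cases i <;> fin_cases j <;> decide

theorem movesOff_hook {t : ℤ} (ht : 0 ≤ t) :
    MovesOff signs (Subgroup.zpowers (hook t) ⊔ signs) (outside t (t + 2)) := by
  refine movesOff_zpowers_sup_signs (fun _ => neg_mem_outside) fun k hk g hg => ?_
  by_cases ht2 : 2 ≤ t
  · exact hook_zpow_mul_notMem ht2 (by rintro rfl; simp at hk) hg
  obtain rfl | rfl : t = 0 ∨ t = 1 := by omega
  · obtain ⟨m, rfl | rfl⟩ := Int.even_or_odd' k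
    · rw [_root_.zpow_mul, show hook 0 ^ (2 : ℤ) = -1 from hook_zero_sq] at hk
      exact absurd (Subgroup.zpow_mem _ (mem_signs.2 (.inr rfl)) _) hk
    · have hs : ((-1 : SL(2, ℤ)) ^ m) ∈ signs := Subgroup.zpow_mem _ (mem_signs.2 (.inr rfl)) _
      have key : hook 0 * g ∉ outside 0 (0 + 2) := by
        have := (abs_le_of_outside le_rfl hg).1
        simp only [outside, Set.mem_ofPred_eq, hook_mul_apply_zero, hook_mul_apply_one, not_lt]
        simp only [zero_mul, sub_zero, zero_add, zero_sub, mul_neg, abs_neg, abs_mul]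
        norm_num
        linarith
      rw [_root_.zpow_add_one, _root_.zpow_mul, show hook 0 ^ (2 : ℤ) = -1 from hook_zero_sq]
      rcases mem_signs.1 hs with e | e <;> rw [e]
      · rwa [one_mul]
      · rwa [neg_one_mul, neg_mul, neg_mem_outside]
  · obtain ⟨m, r, hr, rfl⟩ : ∃ m r : ℤ, (r = 0 ∨ r = 1 ∨ r = 2) ∧ k = 3 * m + r :=
      ⟨k / 3, k % 3, by omega, by omega⟩
    have hs : ((-1 : SL(2, ℤ)) ^ m) ∈ signs := Subgroup.zpow_mem _ (mem_signs.2 (.inr rfl)) _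
    have red : hook 1 ^ (3 * m + r) = (-1) ^ m * hook 1 ^ r := by
      rw [_root_.zpow_add, _root_.zpow_mul, show hook 1 ^ (3 : ℤ) = -1 from hook_one_cube]
    have hA := abs_le_of_outside zero_le_one hg
    have key : hook 1 * g ∉ outside 1 (1 + 2) ∧ hook 1 * (hook 1 * g) ∉ outside 1 (1 + 2) := by
      simp only [outside, Set.mem_ofPred_eq, hook_mul_apply_zero, hook_mul_apply_one, not_lt]
      generalize g 0 0 = u at *
      generalize g 1 0 = v at *
      grind
    rw [red] at hk ⊢
    have hr' : hook 1 ^ r * g ∉ outside 1 (1 + 2) := by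
      rcases hr with rfl | rfl | rfl
      · simp [hs] at hk
      · simpa using key.1
      · rw [show hook 1 ^ (2 : ℤ) = hook 1 * hook 1 from zpow_two _, mul_assoc]
        exact key.2
    rcases mem_signs.1 hs with e | e <;> rw [e]
    · rwa [one_mul]
    · rwa [neg_one_mul, neg_mul, neg_mem_outside]

theorem exists_isThin_of_trace {n : ℕ} {q t p : ℤ} (hq : (n : ℤ) ∣ q) (ht : 0 ≤ t)
    (hp : t + 2 ≤ p) (hpq : 2 * p - t + 2 ≤ q) (hd : (n : ℤ) ∣ p * (t - p) - 1) :
    ∃ H, IsThin n H ∧ ∀ k, t + q * k ∈ traceSet H ∧ -(t + q * k) ∈ traceSet H := by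
  have hfg : signs.FG := (isThin_signs n).fg
  have hfg' : ∀ a : SL(2, ℤ), (Subgroup.zpowers a).FG := fun a =>
    ⟨{a}, by simp [Subgroup.zpowers_eq_closure]⟩
  set H₁ := Subgroup.zpowers (T ^ q) ⊔ signs
  set H₂ := Subgroup.zpowers (hook t) ⊔ signs
  refine ⟨(H₁ ⊔ H₂).map (MulAut.conj (hook p)⁻¹).toMonoidHom, ⟨?_,
    (((hfg' _).sup hfg).sup ((hfg' _).sup hfg)).map_monoidHom _,
    signs_le_conj (le_sup_right.trans le_sup_left) _, 1, ?_⟩, fun k => ?_⟩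
  · rw [Subgroup.map_le_iff_le_comap]
    have hs : signs ≤ (CongruenceSubgroup.Gamma0 n).comap
        (MulAut.conj (hook p)⁻¹).toMonoidHom := by
      intro a ha
      rcases mem_signs.1 ha with rfl | rfl <;> simp [CongruenceSubgroup.Gamma0_mem]
    refine sup_le (sup_le ?_ hs) (sup_le ?_ hs) <;> rw [Subgroup.zpowers_le] <;>
      simp only [MulEquiv.toMonoidHom_eq_coe, Subgroup.mem_comap, MonoidHom.coe_coe,
        MulAut.conj_apply, inv_inv, CongruenceSubgroup.Gamma0_mem,
        ZMod.intCast_zmod_eq_zero_iff_dvd] <;>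
      rw [mul_assoc, hook_inv_mul_apply_one]
    · rw [T_zpow_mul_apply_zero, T_zpow_mul_apply_one]
      simpa [hook] using hq
    · rw [hook_mul_apply_zero, hook_mul_apply_one, show hook p 0 0 = p from rfl,
        show hook p 1 0 = 1 from rfl]
      obtain ⟨c, hc⟩ := hd
      exact ⟨-c, by linear_combination -hc⟩
  · refine (((movesOff_T_zpow (by omega) t).sup le_sup_right le_sup_right
      (movesOff_hook ht) ?_).conj (hook p)⁻¹).mono ?_
    · refine Set.eq_univ_of_forall fun g => ?_
      by_contra hg
      simp only [inside, outside, Set.mem_union, Set.mem_ofPred_eq, not_or, not_lt] at hg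
      have h10 : g 1 0 = 0 := by
        by_contra h
        have := abs_pos.2 h
        nlinarith
      have h00 := hg.2
      simp only [h10, abs_zero, mul_zero, sub_zero, abs_nonpos_iff] at h00
      exact col_ne_zero g (by simpa using h00) h10
    · intro g hg
      simp only [nearInfinity, inside, outside, Set.mem_inter_iff, Set.mem_ofPred_eq, inv_inv,
        hook_mul_apply_zero, hook_mul_apply_one] at hg ⊢
      generalize g 0 0 = u at *
      generalize g 1 0 = v at *
      have e : 2 * (p * u - v) - t * u = (2 * p - t) * u - 2 * v := by ring
      have e1 : |(2 * p - t) * u| = (2 * p - t) * |u| := by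
        rw [abs_mul, abs_of_nonneg (by omega)]
      have e2 : |2 * v| = 2 * |v| := by rw [abs_mul]; norm_num
      have h1 := abs_sub ((2 * p - t) * u) (2 * v)
      have h2 := abs_sub_abs_le_abs_sub ((2 * p - t) * u) (2 * v)
      rw [e]
      rw [e1, e2] at h1 h2
      have h3 := abs_nonneg u
      constructor <;> nlinarith
  · have hT : T ^ (q * k) ∈ H₁ ⊔ H₂ := by
      rw [_root_.zpow_mul]
      exact le_sup_left (a := H₁) (le_sup_left (a := Subgroup.zpowers (T ^ q))
        (Subgroup.zpow_mem _ (Subgroup.mem_zpowers _) k))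
    have hh : hook t ∈ H₁ ⊔ H₂ :=
      le_sup_right (a := H₁) (le_sup_left (a := Subgroup.zpowers (hook t))
        (Subgroup.mem_zpowers _))
    have hn : (-1 : SL(2, ℤ)) ∈ H₁ ⊔ H₂ :=
      le_sup_left (a := H₁) (le_sup_right (a := Subgroup.zpowers (T ^ q))
        (mem_signs.2 (.inr rfl)))
    have htr : Matrix.trace ((T ^ (q * k) * hook t : SL(2, ℤ)) : Matrix (Fin 2) (Fin 2) ℤ)
        = t + q * k := by
      rw [Matrix.SpecialLinearGroup.coe_mul, coe_T_zpow]
      simp [hook, Matrix.trace_fin_two]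
    refine ⟨mem_traceSet_conj _ ⟨_, mul_mem hT hh, htr⟩,
      mem_traceSet_conj _ ⟨_, mul_mem hn (mul_mem hT hh), ?_⟩⟩
    rw [neg_one_mul, Matrix.SpecialLinearGroup.coe_neg, Matrix.trace_neg, htr]

/-- For every positive `n`, there is a finitely generated subgroup of `Γ₀(n)` which has
infinite index in `SL(2, ℤ)` and the same trace set as `Γ₀(n)`. -/
theorem exists_fg_infinite_index_subgroup_traceSet_Gamma0 (n : ℕ) (hn : 0 < n) :
    ∃ H : Subgroup SL(2, ℤ), H ≤ CongruenceSubgroup.Gamma0 n ∧ H.FG ∧ H.index = 0 ∧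
      traceSet H = traceSet (CongruenceSubgroup.Gamma0 n) := by
  classical
  have hn' : (0 : ℤ) < n := by exact_mod_cast hn
  set V : Finset (ℤ × ℤ) := (Finset.Icc 0 (8 * n : ℤ) ×ˢ Finset.Icc 0 (16 * n : ℤ)).filter
    fun x => x.1 + 2 ≤ x.2 ∧ x.2 ≤ x.1 + 1 + n ∧ (n : ℤ) ∣ x.2 * (x.1 - x.2) - 1 with hV
  have hex : ∀ x : ℤ × ℤ, ∃ H, x ∈ V → IsThin n H ∧ ∀ k, x.1 + 16 * n * k ∈ traceSet H ∧
      -(x.1 + 16 * n * k) ∈ traceSet H := by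
    intro x
    by_cases hx : x ∈ V
    · have hx' := hx
      simp only [hV, Finset.mem_filter, Finset.mem_product, Finset.mem_Icc] at hx'
      obtain ⟨⟨⟨h0, h1⟩, -⟩, h2, h3, h4⟩ := hx'
      obtain ⟨H, hH⟩ := exists_isThin_of_trace (q := 16 * n) (dvd_mul_left _ _) h0 h2
        (by omega) h4
      exact ⟨H, fun _ => hH⟩
    · exact ⟨⊥, fun h => (hx h).elim⟩
  choose H hH using hex
  obtain ⟨K, hK, hKV⟩ := exists_isThin_of_finset V H fun x hx => (hH x hx).1
  refine ⟨K, hK.le, hK.fg, hK.index_eq_zero, (traceSet_mono hK.le).antisymm ?_⟩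
  rintro _ ⟨γ, hγ, rfl⟩
  rw [CongruenceSubgroup.Gamma0_mem, ZMod.intCast_zmod_eq_zero_iff_dvd] at hγ
  have hdet := γ.det_coe
  rw [Matrix.det_fin_two] at hdet
  rw [Matrix.trace_fin_two]
  generalize γ 0 0 = a at *
  generalize γ 0 1 = b at *
  generalize γ 1 0 = c at *
  generalize γ 1 1 = d at *
  obtain ⟨c, rfl⟩ := hγ
  obtain ⟨ε, t, k, hε, ht0, ht8, htk⟩ : ∃ ε t k : ℤ, (ε = 1 ∨ ε = -1) ∧ 0 ≤ t ∧ t ≤ 8 * n ∧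
      ε * (a + d) = t + 16 * n * k := by
    have h1 := Int.emod_add_mul_ediv (a + d) (16 * n)
    have h2 := Int.emod_nonneg (a + d) (by omega : (16 * n : ℤ) ≠ 0)
    have h3 := Int.emod_lt_of_pos (a + d) (by omega : (0 : ℤ) < 16 * n)
    by_cases h : (a + d) % (16 * n) ≤ 8 * n
    · exact ⟨1, _, _, .inl rfl, h2, h, by rw [one_mul, h1]⟩
    · refine ⟨-1, 16 * n - (a + d) % (16 * n), -((a + d) / (16 * n)) - 1, .inr rfl,
        by omega, by omega, by linear_combination h1⟩
  obtain ⟨p, j, hp1, hp2, hpj⟩ : ∃ p j : ℤ, t + 2 ≤ p ∧ p ≤ t + 1 + n ∧ p = ε * a + n * j := by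
    have h1 := Int.emod_add_mul_ediv (ε * a - (t + 2)) n
    have h2 := Int.emod_nonneg (ε * a - (t + 2)) hn'.ne'
    have h3 := Int.emod_lt_of_pos (ε * a - (t + 2)) hn'
    exact ⟨t + 2 + (ε * a - (t + 2)) % n, -((ε * a - (t + 2)) / n), by omega, by omega,
      by linear_combination h1⟩
  have hε2 : ε * ε = 1 := by rcases hε with rfl | rfl <;> norm_num
  have hmem : (t, p) ∈ V := by
    simp only [hV, Finset.mem_filter, Finset.mem_product, Finset.mem_Icc]
    refine ⟨⟨⟨ht0, ht8⟩, by omega, by omega⟩, hp1, hp2, ?_⟩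
    refine ⟨b * c - ε * a * (16 * k + j) + j * (ε * d - n * (16 * k + j)), ?_⟩
    obtain rfl : t = ε * (a + d) - 16 * n * k := by linarith
    rw [hpj]
    linear_combination hdet + a * d * hε2
  have := (hH _ hmem).2 k
  apply hKV _ hmem
  rcases hε with rfl | rfl
  · rw [one_mul] at htk
    rw [htk]
    exact this.1
  · rw [show a + d = -(t + 16 * n * k) by linarith]
    exact this.2
end

section
/- For every positive integer n, the set of finite-index subgroups K of the congruence subgroup Γ₀(n) ≤ SL(2,ℤ) satisfying {tr γ : γ ∈ K} = {tr γ : γ ∈ Γ₀(n)} is infinite. -/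
open scoped MatrixGroups

/-- The trace set of a subgroup of `Γ₀(n)`, as a set of integers. -/
def traceSet' (n : ℕ) (K : Subgroup (CongruenceSubgroup.Gamma0 n)) : Set ℤ :=
  {t : ℤ | ∃ γ ∈ K, Matrix.trace (((γ : CongruenceSubgroup.Gamma0 n) : SL(2, ℤ)) :
    Matrix (Fin 2) (Fin 2) ℤ) = t}

open ModularGroup Equiv

/-- The homomorphism out of the cyclic group of order `n` determined by an element `g`
with `g ^ n = 1`. -/
noncomputable def zmodPowHom {G : Type*} [Group G] (n : ℕ) (g : G) (hg : g ^ n = 1) :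
    Multiplicative (ZMod n) →* G :=
  AddMonoidHom.toMultiplicativeLeft
    (ZMod.lift n ⟨zmultiplesHom (Additive G) (Additive.ofMul g), by
      simpa [← ofMul_pow] using congrArg Additive.ofMul hg⟩)

theorem zmodPowHom_ofAdd_natCast {G : Type*} [Group G] {n : ℕ} {g : G} (hg : g ^ n = 1) (k : ℕ) :
    zmodPowHom n g hg (Multiplicative.ofAdd (k : ZMod n)) = g ^ k := by
  have h := ZMod.lift_coe n (⟨zmultiplesHom (Additive G) (Additive.ofMul g), by
      simpa [← ofMul_pow] using congrArg Additive.ofMul hg⟩ :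
        {f : ℤ →+ Additive G // f n = 0}) (k : ℤ)
  simp only [Int.cast_natCast] at h
  simp [zmodPowHom, h]

theorem zmodPowHom_ofAdd_one {G : Type*} [Group G] {n : ℕ} {g : G} (hg : g ^ n = 1) :
    zmodPowHom n g hg (Multiplicative.ofAdd 1) = g := by
  simpa using zmodPowHom_ofAdd_natCast hg 1

/-- The family consisting of the cyclic groups of orders `2` and `3`. -/
abbrev CyclicTwoThree (i : Bool) : Type := Multiplicative (ZMod (bif i then 2 else 3))

/-- The homomorphism from the free product of the cyclic groups of orders `2` and `3`
sending the generators to `s` and `u`. -/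
noncomputable def liftTwoThree {G : Type*} [Group G] (s u : G) (hs : s ^ 2 = 1) (hu : u ^ 3 = 1)
    (i : Bool) : CyclicTwoThree i →* G :=
  match i with
  | true => zmodPowHom 2 s hs
  | false => zmodPowHom 3 u hu

theorem re_S_smul (z : UpperHalfPlane) : (S • z).re = -z.re / Complex.normSq z := by
  rw [UpperHalfPlane.modular_S_smul, ← UpperHalfPlane.coe_re, UpperHalfPlane.coe_mk,
    Complex.inv_re, Complex.normSq_neg, Complex.neg_re, UpperHalfPlane.coe_re]

theorem re_S_smul_pos {z : UpperHalfPlane} (hz : z.re < 0) : 0 < (S • z).re := by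
  rw [re_S_smul]
  exact div_pos (neg_pos.2 hz) z.normSq_pos

theorem re_S_smul_neg {z : UpperHalfPlane} (hz : 0 < z.re) : (S • z).re < 0 := by
  rw [re_S_smul]
  exact div_neg_of_neg_of_pos (neg_neg_of_pos hz) z.normSq_pos

theorem re_S_mul_T_smul_neg {z : UpperHalfPlane} (hz : 0 < z.re) : ((S * T) • z).re < 0 := by
  rw [mul_smul]
  apply re_S_smul_neg
  rw [UpperHalfPlane.modular_T_smul, UpperHalfPlane.vadd_re]
  positivity

theorem S_mul_T_sq : (S * T) ^ 2 = T ^ (-1 : ℤ) * S := by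
  rw [zpow_neg_one, eq_comm, inv_mul_eq_iff_eq_mul]
  decide

theorem re_S_mul_T_sq_smul_neg {z : UpperHalfPlane} (hz : 0 < z.re) :
    ((S * T) ^ 2 • z).re < 0 := by
  rw [S_mul_T_sq, mul_smul,
    UpperHalfPlane.modular_T_zpow_smul, UpperHalfPlane.vadd_re]
  have := re_S_smul_neg hz
  push_cast
  linarith

theorem toPermHom_neg_one : MulAction.toPermHom (SL(2, ℤ)) UpperHalfPlane (-1) = 1 := by
  ext1 z
  change (-1 : SL(2, ℤ)) • z = z
  rw [SL_neg_smul, one_smul]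

theorem toPermHom_S_sq : (MulAction.toPermHom (SL(2, ℤ)) UpperHalfPlane S) ^ 2 = 1 := by
  have h : S ^ 2 = -1 := by decide
  rw [← map_pow, h, toPermHom_neg_one]

theorem toPermHom_S_mul_T_pow_three :
    (MulAction.toPermHom (SL(2, ℤ)) UpperHalfPlane (S * T)) ^ 3 = 1 := by
  have h : (S * T) ^ 3 = -1 := by decide
  rw [← map_pow, h, toPermHom_neg_one]

/-- The action on the upper half-plane identifies the modular group with a free product. -/
theorem injective_lift_liftTwoThree_upperHalfPlane :
    Function.Injective (Monoid.CoprodI.lift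
      (liftTwoThree _ _ toPermHom_S_sq toPermHom_S_mul_T_pow_three)) := by
  refine Monoid.CoprodI.lift_injective_of_ping_pong _ ?_
    (fun i => bif i then {z : UpperHalfPlane | 0 < z.re} else {z : UpperHalfPlane | z.re < 0})
    ?_ ?_ ?_
  · refine .inr ⟨false, ?_⟩
    change 3 ≤ Cardinal.mk (Multiplicative (ZMod 3))
    simp [Cardinal.mk_fintype, ZMod.card]
  · rintro (_ | _)
    · exact ⟨⟨-1 + Complex.I, by simp⟩, by simp [← UpperHalfPlane.coe_re]⟩
    · exact ⟨⟨1 + Complex.I, by simp⟩, by simp [← UpperHalfPlane.coe_re]⟩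
  · have h : Disjoint {z : UpperHalfPlane | 0 < z.re} {z : UpperHalfPlane | z.re < 0} :=
      Set.disjoint_left.2 fun z (h1 : 0 < z.re) (h2 : z.re < 0) => lt_asymm h1 h2
    rintro (_ | _) (_ | _) hij
    · exact absurd rfl hij
    · exact h.symm
    · exact h
    · exact absurd rfl hij
  · rintro (_ | _) (_ | _) hij
    · exact absurd rfl hij
    · intro (h : Multiplicative (ZMod 3)) hh
      rintro _ ⟨z, hz, rfl⟩
      have : h = Multiplicative.ofAdd ((1 : ℕ) : ZMod 3) ∨
          h = Multiplicative.ofAdd ((2 : ℕ) : ZMod 3) := by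
        revert h; decide
      rcases this with rfl | rfl
      · change ((zmodPowHom 3 _ toPermHom_S_mul_T_pow_three _) z).re < 0
        rw [zmodPowHom_ofAdd_natCast, pow_one]
        exact re_S_mul_T_smul_neg hz
      · change ((zmodPowHom 3 _ toPermHom_S_mul_T_pow_three _) z).re < 0
        rw [zmodPowHom_ofAdd_natCast, ← map_pow]
        exact re_S_mul_T_sq_smul_neg hz
    · intro (h : Multiplicative (ZMod 2)) hh
      rintro _ ⟨z, hz, rfl⟩
      have : h = Multiplicative.ofAdd ((1 : ℕ) : ZMod 2) := by
        revert h; decide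
      subst this
      change 0 < ((zmodPowHom 2 _ toPermHom_S_sq _) z).re
      rw [zmodPowHom_ofAdd_natCast, pow_one]
      exact re_S_smul_pos hz
    · exact absurd rfl hij

/-- The universal property of the modular group as a free product of cyclic groups of orders
`2` and `3`. -/
theorem exists_monoidHom_SL2Z {G : Type*} [Group G] (s u : G) (hs : s ^ 2 = 1) (hu : u ^ 3 = 1) :
    ∃ ρ : SL(2, ℤ) →* G, ρ S = s ∧ ρ (S * T) = u := by
  set π := MulAction.toPermHom (SL(2, ℤ)) UpperHalfPlane
  set F := Monoid.CoprodI.lift (liftTwoThree _ _ toPermHom_S_sq toPermHom_S_mul_T_pow_three) with hF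
  have hS : F (Monoid.CoprodI.of (i := true) (Multiplicative.ofAdd (1 : ZMod 2))) = π S := by
    rw [hF, Monoid.CoprodI.lift_of]
    exact zmodPowHom_ofAdd_one toPermHom_S_sq
  have hU : F (Monoid.CoprodI.of (i := false) (Multiplicative.ofAdd (1 : ZMod 3))) =
      π (S * T) := by
    rw [hF, Monoid.CoprodI.lift_of]
    exact zmodPowHom_ofAdd_one toPermHom_S_mul_T_pow_three
  have hrange : ∀ g, π g ∈ F.range := by
    have hle : Subgroup.closure {S, T} ≤ F.range.comap π := by
      rw [Subgroup.closure_le]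
      have hSmem : π S ∈ F.range := ⟨_, hS⟩
      rintro g (rfl | rfl)
      · exact hSmem
      · have : π T = (π S)⁻¹ * π (S * T) := by simp
        change π T ∈ F.range
        rw [this]
        exact mul_mem (inv_mem hSmem) ⟨_, hU⟩
    rw [SpecialLinearGroup.SL2Z_generators] at hle
    exact fun g => hle (Subgroup.mem_top g)
  let e := MonoidHom.ofInjective injective_lift_liftTwoThree_upperHalfPlane
  have he : ∀ g x, F x = π g → e.symm (π.codRestrict F.range hrange g) = x := by
    intro g x h
    rw [MulEquiv.symm_apply_eq]
    exact Subtype.ext h.symm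
  refine ⟨((Monoid.CoprodI.lift (liftTwoThree s u hs hu)).comp e.symm.toMonoidHom).comp
    (π.codRestrict F.range hrange), ?_, ?_⟩
  · change Monoid.CoprodI.lift (liftTwoThree s u hs hu) (e.symm _) = s
    rw [he _ _ hS, Monoid.CoprodI.lift_of]
    exact zmodPowHom_ofAdd_one hs
  · change Monoid.CoprodI.lift (liftTwoThree s u hs hu) (e.symm _) = u
    rw [he _ _ hU, Monoid.CoprodI.lift_of]
    exact zmodPowHom_ofAdd_one hu

/-- Permutations `s` and `u` of orders dividing `2` and `3` generate a transitive group, the point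
`z` is fixed by `s`, and for each `k` some point at which `(s * u) ^ k` and `s` agree has an orbit
under `s * u` that avoids `z`. -/
structure IsDisplacing {X : Type} (s u : Perm X) (z : X) : Prop where
  s_sq : s ^ 2 = 1
  u_pow_three : u ^ 3 = 1
  s_apply : s z = z
  eq_univ : ∀ A : Set X, A.Nonempty → (∀ x ∈ A, s x ∈ A) → (∀ x ∈ A, u x ∈ A) → A = Set.univ
  exists_agree : ∀ k : ℤ, ∃ x, ((s * u) ^ k) x = s x ∧ ∀ j : ℤ, ((s * u) ^ j) x ≠ z

theorem zpow_sumInl_of_avoids {X Y : Type} {t : Perm X} {t' : Perm (X ⊕ Y)} {z x : X}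
    (ht : ∀ y, t y ≠ z → t' (Sum.inl y) = Sum.inl (t y)) (hx : ∀ j : ℤ, (t ^ j) x ≠ z) (j : ℤ) :
    (t' ^ j) (Sum.inl x) = Sum.inl ((t ^ j) x) := by
  induction j using Int.induction_on with
  | zero => simp
  | succ i ih =>
    have h := hx (i + 1)
    rw [add_comm, zpow_one_add, Perm.mul_apply] at h ⊢
    rw [ih, ht _ h, zpow_one_add, Perm.mul_apply]
  | pred i ih =>
    have h : t ((t ^ (-(i : ℤ) - 1)) x) = (t ^ (-(i : ℤ))) x := by
      rw [← Perm.mul_apply, ← zpow_one_add]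
      congr 2
      ring
    apply t'.injective
    rw [ht _ (h ▸ hx _), h, ← ih, ← Perm.mul_apply, ← zpow_one_add]
    congr 2
    ring

theorem IsDisplacing.exists_sum {X : Type} {s u : Perm X} {z : X} (h : IsDisplacing s u z) :
    ∃ (s' u' : Perm (X ⊕ Fin 3)) (z' : X ⊕ Fin 3), IsDisplacing s' u' z' := by
  classical
  let s' : Perm (X ⊕ Fin 3) := swap (Sum.inl z) (Sum.inr 0) * sumCongr s 1
  let u' : Perm (X ⊕ Fin 3) := sumCongr u (finRotate 3)
  have hz : s' (Sum.inl z) = Sum.inr 0 := by simp [s', h.s_apply]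
  have hsl : ∀ x, x ≠ z → s' (Sum.inl x) = Sum.inl (s x) := by
    intro x hx
    have : s x ≠ z := fun hh => hx (s.injective (hh.trans h.s_apply.symm))
    simp [s', swap_apply_of_ne_of_ne, this]
  have hs0 : s' (Sum.inr 0) = Sum.inl z := by simp [s']
  have hsr : ∀ i : Fin 3, i ≠ 0 → s' (Sum.inr i) = Sum.inr i := by
    intro i hi
    simp [s', swap_apply_of_ne_of_ne, hi]
  have hul : ∀ x, u' (Sum.inl x) = Sum.inl (u x) := fun x => rfl
  have hur : ∀ i, u' (Sum.inr i) = Sum.inr (finRotate 3 i) := fun i => rfl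
  have ht : ∀ y, (s * u) y ≠ z → (s' * u') (Sum.inl y) = Sum.inl ((s * u) y) := by
    intro y hy
    rw [Perm.mul_apply, hul, hsl]
    · rfl
    · intro hh
      exact hy (by rw [Perm.mul_apply, hh, h.s_apply])
  refine ⟨s', u', Sum.inr 2, ?_, ?_, hsr 2 (by decide), ?_, ?_⟩
  · ext1 x
    rw [sq, Perm.mul_apply, Perm.one_apply]
    rcases x with x | i
    · by_cases hx : x = z
      · rw [hx, hz, hs0]
      · have : s x ≠ z := fun hh => hx (s.injective (hh.trans h.s_apply.symm))
        rw [hsl x hx, hsl _ this, ← Perm.mul_apply, ← sq, h.s_sq, Perm.one_apply]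
    · by_cases hi : i = 0
      · rw [hi, hs0, hz]
      · rw [hsr i hi, hsr i hi]
  · ext1 x
    simp only [pow_succ, pow_zero, one_mul, Perm.mul_apply, Perm.one_apply]
    rcases x with x | i
    · rw [hul, hul, hul]
      have := congrArg (fun f : Perm X => f x) h.u_pow_three
      simpa only [pow_succ, pow_zero, one_mul, Perm.mul_apply, Perm.one_apply] using
        congrArg Sum.inl this
    · rw [hur, hur, hur]
      congr 1
      revert i
      decide
  · intro A hA hAs hAu
    have hr : ∀ i j : Fin 3, Sum.inr i ∈ A → Sum.inr j ∈ A := by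
      intro i j hi
      have h1 := hAu _ hi
      have h2 := hAu _ h1
      rw [hur] at h1 h2
      rw [hur] at h2
      have : j = i ∨ j = finRotate 3 i ∨ j = finRotate 3 (finRotate 3 i) := by
        clear hi h1 h2
        revert i j
        decide
      rcases this with rfl | rfl | rfl <;> assumption
    have hne : (Sum.inl ⁻¹' A : Set X).Nonempty := by
      obtain ⟨x | i, hx⟩ := hA
      · exact ⟨x, hx⟩
      · exact ⟨z, by simpa [hs0] using hAs _ (hr i 0 hx)⟩
    have huniv := h.eq_univ (Sum.inl ⁻¹' A) hne
      (fun x hx => by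
        by_cases hxz : x = z
        · rwa [hxz, h.s_apply, ← hxz]
        · simpa [hsl x hxz] using hAs _ hx)
      (fun x hx => hAu _ hx)
    have hl : ∀ x, Sum.inl x ∈ A := fun x => huniv.ge (Set.mem_univ x)
    refine Set.eq_univ_of_forall ?_
    rintro (x | i)
    · exact hl x
    · exact hr 0 i (by simpa [hz] using hAs _ (hl z))
  · intro k
    obtain ⟨x, hx, hxz⟩ := h.exists_agree k
    refine ⟨Sum.inl x, ?_, fun j => ?_⟩
    · rw [zpow_sumInl_of_avoids ht hxz, hx, hsl x (by simpa using hxz 0)]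
    · rw [zpow_sumInl_of_avoids ht hxz]
      exact Sum.inl_ne_inr

/-- An involution of 22 points, paired with `permU`. -/
def permS : Perm (Fin 22) :=
  let f : Fin 22 → Fin 22 :=
    ![0, 3, 4, 1, 2, 6, 5, 9, 10, 7, 8, 15, 16, 14, 13, 11, 12, 20, 21, 19, 17, 18]
  ⟨f, f, by decide +kernel, by decide +kernel⟩

/-- A permutation of order 3 of 22 points, paired with `permS`. -/
def permU : Perm (Fin 22) :=
  let f : Fin 22 → Fin 22 :=
    ![1, 2, 0, 4, 5, 3, 7, 8, 6, 11, 13, 12, 9, 14, 10, 17, 19, 18, 15, 20, 16, 21]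
  ⟨f, f ∘ f, by decide +kernel, by decide +kernel⟩

theorem zpow_apply_eq_pow_mod {X : Type} {t : Perm X} {x : X} {m : ℕ} (hm : 0 < m)
    (hx : (t ^ m) x = x) (k : ℤ) : ∃ r : Fin m, (t ^ k) x = (t ^ (r : ℕ)) x ∧ (r : ℤ) = k % m := by
  have h0 : 0 ≤ k % m := Int.emod_nonneg _ (by positivity)
  have h1 : k % m < m := Int.emod_lt_of_pos _ (by positivity)
  refine ⟨⟨(k % m).toNat, by omega⟩, ?_, by simpa using h0⟩
  have hk : k = ((k % m).toNat : ℤ) + m * (k / m) := by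
    rw [Int.toNat_of_nonneg h0, Int.emod_add_mul_ediv]
  conv_lhs => rw [hk]
  rw [zpow_add, Perm.mul_apply, zpow_mul, zpow_natCast, zpow_natCast,
    Perm.zpow_apply_eq_self_of_apply_eq_self hx]

theorem exists_zpow_agree {X : Type} {s t : Perm X} {z : X} {m : ℕ} (hm : 0 < m)
    (h : ∀ r : Fin m, ∃ x, (t ^ (r : ℕ)) x = s x ∧ (t ^ m) x = x ∧
      ∀ j : Fin m, (t ^ (j : ℕ)) x ≠ z) (k : ℤ) :
    ∃ x, (t ^ k) x = s x ∧ ∀ j : ℤ, (t ^ j) x ≠ z := by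
  have h0 : 0 ≤ k % m := Int.emod_nonneg _ (by positivity)
  have h1 : k % m < m := Int.emod_lt_of_pos _ (by positivity)
  obtain ⟨x, hx, hxm, hxz⟩ := h ⟨(k % m).toNat, by omega⟩
  refine ⟨x, ?_, fun j => ?_⟩
  · obtain ⟨r, hr, hrk⟩ := zpow_apply_eq_pow_mod hm hxm k
    have : (r : ℕ) = (k % m).toNat := by omega
    rw [hr, this, ← hx]
  · obtain ⟨r, hr, -⟩ := zpow_apply_eq_pow_mod hm hxm j
    rw [hr]
    exact hxz r

theorem isDisplacing_permS_permU : IsDisplacing permS permU 0 where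
  s_sq := by decide +kernel
  u_pow_three := by decide +kernel
  s_apply := by decide +kernel
  eq_univ A hA hs hu := by
    have step : ∀ y : Fin 22, y ≠ 0 → ∃ x < y, (permS x = y ∧ permS y = x) ∨
        (permU x = y ∧ permU (permU y) = x) ∨ (permU (permU x) = y ∧ permU y = x) := by
      decide +kernel
    have key : ∀ y : Fin 22, y ∈ A ↔ 0 ∈ A := by
      intro y
      induction y using WellFoundedLT.induction with
      | ind y ih =>
        by_cases hy : y = 0
        · rw [hy]
        obtain ⟨x, hxy, h⟩ := step y hy
        rw [← ih x hxy]
        rcases h with ⟨h1, h2⟩ | ⟨h1, h2⟩ | ⟨h1, h2⟩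
        · exact ⟨fun h => h2 ▸ hs _ h, fun h => h1 ▸ hs _ h⟩
        · exact ⟨fun h => h2 ▸ hu _ (hu _ h), fun h => h1 ▸ hu _ h⟩
        · exact ⟨fun h => h2 ▸ hu _ h, fun h => h1 ▸ hu _ (hu _ h)⟩
    obtain ⟨x, hx⟩ := hA
    exact Set.eq_univ_of_forall fun y => (key y).2 ((key x).1 hx)
  exists_agree := exists_zpow_agree (m := 12) (by norm_num) (by decide +kernel)

theorem exists_isDisplacing (l : ℕ) : ∃ (X : Type) (_ : Finite X) (s u : Perm X) (z : X),
    Nat.card X = 22 + 3 * l ∧ IsDisplacing s u z := by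
  induction l with
  | zero => exact ⟨Fin 22, inferInstance, permS, permU, 0, by simp, isDisplacing_permS_permU⟩
  | succ l ih =>
    obtain ⟨X, hX, s, u, z, hcard, h⟩ := ih
    obtain ⟨s', u', z', hsum⟩ := h.exists_sum
    refine ⟨X ⊕ Fin 3, inferInstance, s', u', z', ?_, hsum⟩
    rw [Nat.card_sum, hcard, Nat.card_fin]
    ring

/-- A transitive action of a group on a finite set remains transitive on a subgroup of finite
index coprime to the size of the set. -/
theorem isPretransitive_of_coprime_index {G X : Type*} [Group G] [MulAction G X] [Finite X]
    [MulAction.IsPretransitive G X] (H : Subgroup G)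
    (hH : (Nat.card X).Coprime H.index) : MulAction.IsPretransitive H X := by
  rcases isEmpty_or_nonempty X with hX | ⟨⟨x⟩⟩
  · exact ⟨fun x => isEmptyElim x⟩
  set K := MulAction.stabilizer G x
  have hK : K.index = Nat.card X := MulAction.index_stabilizer_of_transitive G x
  have hrel : K.relIndex H = (MulAction.orbit H x).ncard := by
    rw [← MulAction.index_stabilizer]
    rfl
  have hdvd : Nat.card X ∣ K.relIndex H := by
    refine hH.dvd_of_dvd_mul_right ?_
    rw [← Subgroup.inf_relIndex_right, Subgroup.relIndex_mul_index inf_le_right, ← hK]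
    exact Subgroup.index_dvd_of_le inf_le_left
  have hpos : 0 < (MulAction.orbit H x).ncard :=
    (Set.ncard_pos (Set.toFinite _)).2 ⟨x, MulAction.mem_orbit_self x⟩
  have huniv : MulAction.orbit H x = Set.univ := by
    refine Set.eq_of_subset_of_ncard_le (Set.subset_univ _) ?_ (Set.toFinite _)
    rw [Set.ncard_univ]
    exact Nat.le_of_dvd hpos (hrel ▸ hdvd)
  exact MulAction.isPretransitive_iff_orbit_eq_univ x |>.2 huniv

/-- Any trace of an element of `Γ₀(n)` is attained by a conjugate of `S * T ^ t` that lies in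
`Γ₀(n)`. -/
theorem exists_conj_S_mul_T_zpow_mem_Gamma0 {n : ℕ} {γ : SL(2, ℤ)}
    (hγ : γ ∈ CongruenceSubgroup.Gamma0 n) :
    ∃ P : SL(2, ℤ), P * (S * T ^ (γ 0 0 + γ 1 1)) * P⁻¹ ∈ CongruenceSubgroup.Gamma0 n := by
  let P : SL(2, ℤ) := ⟨!![1, 0; γ 1 1, 1], by simp⟩
  have hdet : γ 0 0 * γ 1 1 - γ 0 1 * γ 1 0 = 1 := by
    rw [← Matrix.det_fin_two, γ.det_coe]
  have hentry : ((P * (S * T ^ (γ 0 0 + γ 1 1)) * P⁻¹ : SL(2, ℤ)) :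
      Matrix (Fin 2) (Fin 2) ℤ) 1 0 = -(γ 0 1 * γ 1 0) := by
    rw [Matrix.SpecialLinearGroup.coe_mul, Matrix.SpecialLinearGroup.coe_mul,
      Matrix.SpecialLinearGroup.coe_mul, Matrix.SpecialLinearGroup.coe_inv, coe_S, coe_T_zpow]
    simp [P, Matrix.mul_apply, Fin.sum_univ_two, Matrix.adjugate_fin_two]
    linarith
  refine ⟨P, ?_⟩
  rw [CongruenceSubgroup.Gamma0_mem] at hγ ⊢
  rw [hentry]
  simp [hγ]

theorem trace_conj_S_mul_T_zpow (P : SL(2, ℤ)) (t : ℤ) :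
    Matrix.trace ((P * (S * T ^ t) * P⁻¹ : SL(2, ℤ)) : Matrix (Fin 2) (Fin 2) ℤ) = t := by
  rw [Matrix.SpecialLinearGroup.coe_mul, Matrix.trace_mul_comm,
    ← Matrix.SpecialLinearGroup.coe_mul, inv_mul_cancel_left,
    Matrix.SpecialLinearGroup.coe_mul, coe_S, coe_T_zpow]
  simp [Matrix.trace_fin_two]

/-- A transitive action of the modular group in which each `S * T ^ t` fixes a point yields, when
its degree is coprime to the index of `Γ₀(n)`, a subgroup of `Γ₀(n)` with the same trace set. -/
theorem traceSet'_stabilizer {n : ℕ} {X : Type*} [MulAction SL(2, ℤ) X]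
    [MulAction.IsPretransitive (CongruenceSubgroup.Gamma0 n) X]
    (hfix : ∀ t : ℤ, ∃ x : X, (S * T ^ t) • x = x) (x₀ : X) :
    traceSet' n (MulAction.stabilizer (CongruenceSubgroup.Gamma0 n) x₀) =
      traceSet (CongruenceSubgroup.Gamma0 n) := by
  refine Set.Subset.antisymm ?_ ?_
  · rintro t ⟨γ, -, ht⟩
    exact ⟨γ, γ.2, ht⟩
  · rintro t ⟨γ, hγ, ht⟩
    rw [Matrix.trace_fin_two] at ht
    obtain ⟨P, hP⟩ := exists_conj_S_mul_T_zpow_mem_Gamma0 hγ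
    rw [ht] at hP
    obtain ⟨x, hx⟩ := hfix t
    obtain ⟨g, hg⟩ := MulAction.exists_smul_eq (CongruenceSubgroup.Gamma0 n) x₀ (P • x)
    refine ⟨g⁻¹ * ⟨_, hP⟩ * g, ?_, ?_⟩
    · rw [MulAction.mem_stabilizer_iff, mul_smul, mul_smul, hg, inv_smul_eq_iff, hg]
      change (P * (S * T ^ t) * P⁻¹) • P • x = P • x
      rw [mul_smul, inv_smul_smul, mul_smul, hx]
    · have h : ((g⁻¹ * ⟨_, hP⟩ * g : CongruenceSubgroup.Gamma0 n) : SL(2, ℤ)) =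
          ((g : SL(2, ℤ))⁻¹ * P) * (S * T ^ t) * ((g : SL(2, ℤ))⁻¹ * P)⁻¹ := by
        simp [mul_assoc]
      rw [h]
      exact trace_conj_S_mul_T_zpow _ t

theorem exists_subgroup_index_eq {n : ℕ} (l : ℕ)
    (hl : (22 + 3 * l).Coprime (CongruenceSubgroup.Gamma0 n).index) :
    ∃ K : Subgroup (CongruenceSubgroup.Gamma0 n), K.index = 22 + 3 * l ∧
      traceSet' n K = traceSet (CongruenceSubgroup.Gamma0 n) := by
  obtain ⟨X, hX, s, u, z, hcard, h⟩ := exists_isDisplacing l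
  obtain ⟨ρ, hS, hST⟩ := exists_monoidHom_SL2Z s u h.s_sq h.u_pow_three
  let _ : MulAction SL(2, ℤ) X := MulAction.compHom X ρ
  have hT : ρ T = s * u := by
    rw [← hST, map_mul, hS, ← mul_assoc, ← sq, h.s_sq, one_mul]
  have : MulAction.IsPretransitive SL(2, ℤ) X := by
    rw [MulAction.isPretransitive_iff_orbit_eq_univ z]
    refine h.eq_univ _ ⟨z, MulAction.mem_orbit_self z⟩ ?_ ?_
    · rintro _ ⟨g, rfl⟩
      exact ⟨S * g, by rw [← hS]; exact mul_smul S g z⟩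
    · rintro _ ⟨g, rfl⟩
      exact ⟨S * T * g, by rw [← hST]; exact mul_smul (S * T) g z⟩
  have : MulAction.IsPretransitive (CongruenceSubgroup.Gamma0 n) X :=
    isPretransitive_of_coprime_index _ (hcard ▸ hl)
  refine ⟨MulAction.stabilizer (CongruenceSubgroup.Gamma0 n) z, ?_, traceSet'_stabilizer ?_ z⟩
  · rw [MulAction.index_stabilizer_of_transitive, hcard]
  · intro t
    obtain ⟨x, hx, -⟩ := h.exists_agree t
    refine ⟨x, ?_⟩
    change ρ (S * T ^ t) x = x
    rw [map_mul, map_zpow, hT, hS, Perm.mul_apply, hx, ← Perm.mul_apply, ← sq, h.s_sq,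
      Perm.one_apply]

/-- For every positive `n`, there are infinitely many finite-index subgroups of `Γ₀(n)`
with the same trace set as `Γ₀(n)`. -/
theorem infinite_finite_index_subgroups_traceSet_Gamma0 (n : ℕ) (hn : 0 < n) :
    {K : Subgroup (CongruenceSubgroup.Gamma0 n) | K.FiniteIndex ∧
      traceSet' n K = traceSet (CongruenceSubgroup.Gamma0 n)}.Infinite := by
  have : NeZero n := ⟨hn.ne'⟩
  have hpos : 0 < (CongruenceSubgroup.Gamma0 n).index :=
    Nat.pos_of_ne_zero Subgroup.FiniteIndex.index_ne_zero
  refine Set.Infinite.of_image Subgroup.index (Set.infinite_of_not_bddAbove ?_)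
  rintro ⟨B, hB⟩
  obtain ⟨p, hp, hprime, hmod⟩ := Nat.forall_exists_prime_gt_and_modEq
    (max B (max 22 (CongruenceSubgroup.Gamma0 n).index)) (q := 3) (a := 1) (by norm_num) (by simp)
  simp only [gt_iff_lt, max_lt_iff] at hp
  obtain ⟨hpB, hp22, hpn⟩ := hp
  obtain ⟨l, rfl⟩ : ∃ l, p = 22 + 3 * l := ⟨(p - 22) / 3, by
    rw [Nat.ModEq] at hmod
    omega⟩
  obtain ⟨K, hK, hKtr⟩ := exists_subgroup_index_eq (n := n) l
    (hprime.coprime_iff_not_dvd.2 fun h => (Nat.le_of_dvd hpos h).not_gt hpn)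
  have hmem : K.index ≤ B := hB ⟨K, ⟨⟨by omega⟩, hKtr⟩, rfl⟩
  omega
end

section
/- For every integer n ≥ 3, the subgroup H of SL(2,ℤ) generated by the two matrices [[1,n],[0,1]] and [[1,0],[n,1]] has infinite index in SL(2,ℤ), and its trace set equals the set of integers congruent to 2 modulo n²: {tr γ : γ ∈ H} = {t ∈ ℤ : t ≡ 2 (mod n²)}. -/
open scoped MatrixGroups

/-- The elementary matrix `[[1,x],[0,1]]` for `false`, and `[[1,0],[x,1]]` for `true`. -/
def elementary : Bool → ℤ → SL(2, ℤ)
  | false, x => ⟨!![1, x; 0, 1], by simp [Matrix.det_fin_two_of]⟩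
  | true, x => ⟨!![1, 0; x, 1], by simp [Matrix.det_fin_two_of]⟩

lemma coe_elementary_false (x : ℤ) :
    (elementary false x : Matrix (Fin 2) (Fin 2) ℤ) = !![1, x; 0, 1] := rfl

lemma coe_elementary_true (x : ℤ) :
    (elementary true x : Matrix (Fin 2) (Fin 2) ℤ) = !![1, 0; x, 1] := rfl

lemma elementary_mul (b : Bool) (x y : ℤ) :
    elementary b x * elementary b y = elementary b (x + y) := by
  cases b <;> ext i j <;> fin_cases i <;> fin_cases j <;>
    simp [coe_elementary_false, coe_elementary_true, add_comm]

lemma elementary_zero (b : Bool) : elementary b 0 = 1 := by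
  cases b <;> ext i j <;> fin_cases i <;> fin_cases j <;> simp [elementary]

lemma elementary_inv (b : Bool) (x : ℤ) : (elementary b x)⁻¹ = elementary b (-x) := by
  rw [inv_eq_iff_mul_eq_one, elementary_mul, add_neg_cancel, elementary_zero]

lemma elementary_mul_mem {H : Subgroup SL(2, ℤ)} {b : Bool} {x : ℤ} (h : elementary b x ∈ H)
    (k : ℕ) : elementary b (x * k) ∈ H := by
  induction k with
  | zero => simp [elementary_zero, H.one_mem]
  | succ k ih =>
    have := H.mul_mem ih h
    rwa [elementary_mul, show x * (k : ℤ) + x = x * ((k + 1 : ℕ) : ℤ) by push_cast; ring] at this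

/-- `IsReducedWord n b g` says that `g` is an alternating product of nontrivial elementary matrices
with entries divisible by `n`, whose leftmost factor (if any) is not of type `b`. -/
inductive IsReducedWord_s10 (n : ℤ) : Bool → SL(2, ℤ) → Prop
  | one (b : Bool) : IsReducedWord_s10 n b 1
  | cons (b : Bool) (g : SL(2, ℤ)) (x : ℤ) (hx : x ≠ 0) (hn : n ∣ x) (h : IsReducedWord_s10 n b g) :
      IsReducedWord_s10 n (!b) (elementary b x * g)

lemma IsReducedWord_s10.exists_elementary_mul {n : ℤ} {b : Bool} {g : SL(2, ℤ)}
    (h : IsReducedWord_s10 n b g) (c : Bool) {x : ℤ} (hn : n ∣ x) :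
    ∃ d, IsReducedWord_s10 n d (elementary c x * g) := by
  rcases eq_or_ne x 0 with rfl | hx
  · exact ⟨b, by rwa [elementary_zero, one_mul]⟩
  cases h with
  | one => exact ⟨_, .cons c 1 x hx hn (.one c)⟩
  | cons b g y hy hny h =>
    by_cases hbc : b = c
    · subst hbc
      rw [← mul_assoc, elementary_mul]
      by_cases hxy : x + y = 0
      · exact ⟨b, by rwa [hxy, elementary_zero, one_mul]⟩
      · exact ⟨_, .cons b g _ hxy (dvd_add hn hny) h⟩
    · obtain rfl : c = !b := by cases b <;> cases c <;> simp_all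
      exact ⟨_, .cons _ _ x hx hn (.cons b g y hy hny h)⟩

lemma two_mul_abs_le_abs_add_mul {n x u v : ℤ} (hn : 3 ≤ n) (hx : x ≠ 0) (hnx : n ∣ x)
    (huv : |u| ≤ |v|) : 2 * |v| ≤ |u + x * v| := by
  have h3 : 3 ≤ |x| := by
    have := Int.le_of_dvd (abs_pos.mpr hx) ((dvd_abs n x).mpr hnx)
    omega
  have h1 : |x * v| ≤ |u + x * v| + |u| := by
    simpa using abs_sub (u + x * v) u
  rw [abs_mul] at h1
  nlinarith [abs_nonneg v]

/-- Ping-pong on the orbit of the vector `(1, 1)`. -/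
lemma IsReducedWord_s10.eq_one_or_two_mul_abs_le {n : ℤ} (hn : 3 ≤ n) {b : Bool} {g : SL(2, ℤ)}
    (h : IsReducedWord_s10 n b g) :
    g = 1 ∨ (b = true ∧ g 0 0 + g 0 1 ≠ 0 ∧ 2 * |g 1 0 + g 1 1| ≤ |g 0 0 + g 0 1|) ∨
      (b = false ∧ g 1 0 + g 1 1 ≠ 0 ∧ 2 * |g 0 0 + g 0 1| ≤ |g 1 0 + g 1 1|) := by
  induction h with
  | one => exact .inl rfl
  | cons b g x hx hnx _ ih =>
    right
    cases b
    · left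
      have hg : g 1 0 + g 1 1 ≠ 0 ∧ |g 0 0 + g 0 1| ≤ |g 1 0 + g 1 1| := by
        rcases ih with rfl | ⟨hb, -⟩ | ⟨-, h0, h⟩
        · simp
        · simp at hb
        · exact ⟨h0, by linarith [abs_nonneg (g 0 0 + g 0 1)]⟩
      have key := two_mul_abs_le_abs_add_mul hn hx hnx hg.2
      have h0 : (elementary false x * g) 0 0 + (elementary false x * g) 0 1 =
          g 0 0 + g 0 1 + x * (g 1 0 + g 1 1) := by
        simp [coe_elementary_false, Matrix.mul_apply, Fin.sum_univ_two]
        ring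
      have h1 : (elementary false x * g) 1 0 + (elementary false x * g) 1 1 =
          g 1 0 + g 1 1 := by
        simp [coe_elementary_false, Matrix.mul_apply, Fin.sum_univ_two]
      rw [h0, h1]
      refine ⟨rfl, abs_pos.mp ?_, key⟩
      linarith [abs_pos.mpr hg.1]
    · right
      have hg : g 0 0 + g 0 1 ≠ 0 ∧ |g 1 0 + g 1 1| ≤ |g 0 0 + g 0 1| := by
        rcases ih with rfl | ⟨-, h0, h⟩ | ⟨hb, -⟩
        · simp
        · exact ⟨h0, by linarith [abs_nonneg (g 1 0 + g 1 1)]⟩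
        · simp at hb
      have key := two_mul_abs_le_abs_add_mul hn hx hnx hg.2
      have h0 : (elementary true x * g) 0 0 + (elementary true x * g) 0 1 =
          g 0 0 + g 0 1 := by
        simp [coe_elementary_true, Matrix.mul_apply, Fin.sum_univ_two]
      have h1 : (elementary true x * g) 1 0 + (elementary true x * g) 1 1 =
          g 1 0 + g 1 1 + x * (g 0 0 + g 0 1) := by
        simp [coe_elementary_true, Matrix.mul_apply, Fin.sum_univ_two]
        ring
      rw [h0, h1]
      refine ⟨rfl, abs_pos.mp ?_, key⟩
      linarith [abs_pos.mpr hg.1]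

lemma exists_isReducedWord_of_mem_closure {n : ℤ} {g : SL(2, ℤ)}
    (hg : g ∈ Subgroup.closure {elementary false n, elementary true n}) :
    ∃ b, IsReducedWord_s10 n b g := by
  induction hg using Subgroup.closure_induction_left with
  | one => exact ⟨true, .one _⟩
  | mul_left x hx y _ ih =>
    obtain ⟨b, hb⟩ := ih
    rcases hx with rfl | rfl <;> exact hb.exists_elementary_mul _ dvd_rfl
  | inv_mul_cancel x hx y _ ih =>
    obtain ⟨b, hb⟩ := ih
    rcases hx with rfl | rfl <;> rw [elementary_inv] <;>
      exact hb.exists_elementary_mul _ (dvd_neg.mpr dvd_rfl)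

lemma eq_one_of_mem_closure_of_fixes {n : ℤ} (hn : 3 ≤ n) {g : SL(2, ℤ)}
    (hg : g ∈ Subgroup.closure {elementary false n, elementary true n})
    (h0 : g 0 0 + g 0 1 = 1) (h1 : g 1 0 + g 1 1 = 1) : g = 1 := by
  obtain ⟨b, hb⟩ := exists_isReducedWord_of_mem_closure hg
  simpa [h0, h1] using hb.eq_one_or_two_mul_abs_le hn

/-- A parabolic matrix fixing the vector `(1, 1)`. -/
def parabolicFixingOnes : SL(2, ℤ) := ⟨!![0, 1; -1, 2], by simp [Matrix.det_fin_two_of]⟩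

lemma coe_parabolicFixingOnes_pow (k : ℕ) :
    ((parabolicFixingOnes ^ k : SL(2, ℤ)) : Matrix (Fin 2) (Fin 2) ℤ) =
      !![1 - (k : ℤ), k; -k, 1 + k] := by
  induction k with
  | zero => simp [Matrix.one_fin_two]
  | succ k ih =>
    rw [pow_succ, Matrix.SpecialLinearGroup.coe_mul, ih]
    ext i j
    fin_cases i <;> fin_cases j <;>
      simp [parabolicFixingOnes, Matrix.mul_apply, Fin.sum_univ_two] <;> ring

lemma index_closure_elementary {n : ℤ} (hn : 3 ≤ n) :
    (Subgroup.closure {elementary false n, elementary true n}).index = 0 := by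
  by_contra hindex
  obtain ⟨k, hk, -, hmem⟩ := Subgroup.exists_pow_mem_of_index_ne_zero hindex parabolicFixingOnes
  have h := eq_one_of_mem_closure_of_fixes hn hmem
    (by simp [coe_parabolicFixingOnes_pow, -Matrix.SpecialLinearGroup.coe_pow])
    (by simp [coe_parabolicFixingOnes_pow, -Matrix.SpecialLinearGroup.coe_pow])
  have h01 := congrArg (fun g : SL(2, ℤ) => g 0 1) h
  simp [coe_parabolicFixingOnes_pow, -Matrix.SpecialLinearGroup.coe_pow] at h01
  omega

/-- Matrices `[[a,b],[c,d]]` with `a ≡ d ≡ 1` modulo `n²` and `b ≡ c ≡ 0` modulo `n`. -/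
def diagonalCongruenceSubgroup (n : ℤ) : Subgroup SL(2, ℤ) where
  carrier := {g | n ^ 2 ∣ g 0 0 - 1 ∧ n ∣ g 0 1 ∧ n ∣ g 1 0 ∧ n ^ 2 ∣ g 1 1 - 1}
  one_mem' := by simp
  mul_mem' := by
    rintro g h ⟨⟨a, ha⟩, ⟨b, hb⟩, ⟨c, hc⟩, ⟨d, hd⟩⟩ ⟨⟨a', ha'⟩, ⟨b', hb'⟩, ⟨c', hc'⟩, ⟨d', hd'⟩⟩
    rw [sub_eq_iff_eq_add] at ha hd ha' hd'
    simp only [Set.mem_ofPred_eq, Matrix.SpecialLinearGroup.coe_mul, Matrix.mul_apply,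
      Fin.sum_univ_two, ha, hb, hc, hd, ha', hb', hc', hd']
    exact ⟨⟨n ^ 2 * a * a' + a + a' + b * c', by ring⟩,
      ⟨n ^ 2 * a * b' + b' + b * (n ^ 2 * d' + 1), by ring⟩,
      ⟨c * (n ^ 2 * a' + 1) + (n ^ 2 * d + 1) * c', by ring⟩,
      ⟨c * b' + n ^ 2 * d * d' + d + d', by ring⟩⟩
  inv_mem' := by
    rintro g ⟨ha, hb, hc, hd⟩
    rw [Set.mem_ofPred_eq, Matrix.SpecialLinearGroup.SL2_inv_expl]
    exact ⟨hd, (dvd_neg (α := ℤ)).mpr hb, (dvd_neg (α := ℤ)).mpr hc, ha⟩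

lemma mem_diagonalCongruenceSubgroup {n : ℤ} {g : SL(2, ℤ)} :
    g ∈ diagonalCongruenceSubgroup n ↔
      n ^ 2 ∣ g 0 0 - 1 ∧ n ∣ g 0 1 ∧ n ∣ g 1 0 ∧ n ^ 2 ∣ g 1 1 - 1 :=
  Iff.rfl

lemma closure_elementary_le (n : ℤ) :
    Subgroup.closure {elementary false n, elementary true n} ≤ diagonalCongruenceSubgroup n := by
  rw [Subgroup.closure_le]
  rintro _ (rfl | rfl) <;>
    simp [mem_diagonalCongruenceSubgroup, coe_elementary_false, coe_elementary_true]

lemma elementary_mul_int_mem {H : Subgroup SL(2, ℤ)} {b : Bool} {x : ℤ}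
    (h : elementary b x ∈ H) (k : ℤ) : elementary b (x * k) ∈ H := by
  obtain ⟨k, rfl | rfl⟩ := k.eq_nat_or_neg
  · exact elementary_mul_mem h k
  · rw [mul_neg, ← elementary_inv]
    exact H.inv_mem (elementary_mul_mem h k)

lemma traceSet_closure_elementary (n : ℤ) :
    traceSet (Subgroup.closure {elementary false n, elementary true n}) =
      {t : ℤ | t ≡ 2 [ZMOD n ^ 2]} := by
  ext t
  constructor
  · rintro ⟨g, hg, rfl⟩
    obtain ⟨ha, -, -, hd⟩ := closure_elementary_le n hg
    refine (Int.modEq_iff_dvd.mpr ?_).symm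
    rw [Matrix.trace_fin_two]
    have h := dvd_add ha hd
    rwa [show g 0 0 - 1 + (g 1 1 - 1) = g 0 0 + g 1 1 - 2 by ring] at h
  · intro ht
    obtain ⟨k, hk⟩ := Int.modEq_iff_dvd.mp (Int.ModEq.symm ht)
    refine ⟨elementary false (n * k) * elementary true n, Subgroup.mul_mem _
      (elementary_mul_int_mem (Subgroup.subset_closure (by simp)) k)
      (Subgroup.subset_closure (by simp)), ?_⟩
    simp [coe_elementary_false, coe_elementary_true, Matrix.trace_fin_two]
    linarith

/-- For `n ≥ 3`, the subgroup of `SL(2, ℤ)` generated by `[[1,n],[0,1]]` and `[[1,0],[n,1]]`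
has infinite index and trace set the integers congruent to `2` modulo `n²`. -/
theorem closure_two_parabolics_infinite_index_traceSet (n : ℕ) (hn : 3 ≤ n) :
    (Subgroup.closure
        ({⟨!![1, (n : ℤ); 0, 1], by simp [Matrix.det_fin_two_of]⟩,
          ⟨!![1, 0; (n : ℤ), 1], by simp [Matrix.det_fin_two_of]⟩} : Set SL(2, ℤ))).index = 0 ∧
      traceSet (Subgroup.closure
        ({⟨!![1, (n : ℤ); 0, 1], by simp [Matrix.det_fin_two_of]⟩,
          ⟨!![1, 0; (n : ℤ), 1], by simp [Matrix.det_fin_two_of]⟩} : Set SL(2, ℤ))) =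
        {t : ℤ | t ≡ 2 [ZMOD (n : ℤ) ^ 2]} := by
  exact ⟨index_closure_elementary (by exact_mod_cast hn), traceSet_closure_elementary n⟩
end

section
/- If H is a subgroup of SL(2,ℤ) containing -I whose index in SL(2,ℤ) is 2 or 3 (equivalently, a subgroup of PSL₂(ℤ) of index 2 or 3), then the absolute trace set of H is not all of ℕ: {|tr γ| : γ ∈ H} ≠ ℕ. -/
open scoped MatrixGroups

open ModularGroup Matrix in
lemma coe_T_zpow_conj (g : SL(2, ℤ)) (n : ℤ) :
    ((T ^ n * g * (T ^ n)⁻¹ : SL(2, ℤ)) : Matrix (Fin 2) (Fin 2) ℤ) =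
      !![g 0 0 + n * g 1 0, g 0 1 + n * g 1 1 - n * (g 0 0 + n * g 1 0);
        g 1 0, g 1 1 - n * g 1 0] := by
  rw [← _root_.zpow_neg, Matrix.SpecialLinearGroup.coe_mul, Matrix.SpecialLinearGroup.coe_mul,
    coe_T_zpow, coe_T_zpow]
  ext i j
  fin_cases i <;> fin_cases j <;> simp [vecMul, dotProduct, mul_apply, Fin.sum_univ_two] <;> ring

open ModularGroup Matrix in
lemma coe_S_conj (g : SL(2, ℤ)) :
    ((S * g * S⁻¹ : SL(2, ℤ)) : Matrix (Fin 2) (Fin 2) ℤ) =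
      !![g 1 1, -g 1 0; -g 0 1, g 0 0] := by
  rw [Matrix.SpecialLinearGroup.coe_mul, Matrix.SpecialLinearGroup.coe_mul,
    Matrix.SpecialLinearGroup.coe_inv, coe_S]
  ext i j
  fin_cases i <;> fin_cases j <;>
    simp [vecMul, dotProduct, mul_apply, Fin.sum_univ_two, adjugate_fin_two]

lemma Int.exists_abs_two_mul_add_sub_le (a t : ℤ) {c : ℤ} (hc : c ≠ 0) :
    ∃ n : ℤ, |2 * (a + n * c) - t| ≤ |c| := by
  have h1 := Int.emod_nonneg (2 * a - t + |c|) (b := 2 * |c|) (by positivity)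
  have h2 := Int.emod_lt_of_pos (2 * a - t + |c|) (b := 2 * |c|) (by positivity)
  have h3 := Int.emod_add_mul_ediv (2 * a - t + |c|) (2 * |c|)
  set q := (2 * a - t + |c|) / (2 * |c|)
  refine ⟨-(q * c.sign), ?_⟩
  have h4 : q * c.sign * c = |c| * q := by rw [mul_assoc, Int.sign_mul_self_eq_abs, mul_comm]
  rw [neg_mul, h4, abs_le]
  constructor <;> linarith

open ModularGroup Matrix in
/-- An elliptic element of `SL(2, ℤ)` of trace `t` is conjugate to the companion matrix of its
characteristic polynomial or to the transpose of that matrix. -/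
lemma isConj_of_abs_trace_le_one (g : SL(2, ℤ)) (t : ℤ) (ht : |t| ≤ 1)
    (hg : g 0 0 + g 1 1 = t) : IsConj g (S * T ^ t) ∨ IsConj g (-(S * T ^ (-t))) := by
  induction hk : (g 1 0).natAbs using Nat.strong_induction_on generalizing g with
  | _ k ih =>
  have key : ∀ g : SL(2, ℤ), g 0 0 + g 1 1 = t →
      (2 * g 0 0 - t) ^ 2 + 4 * (g 0 1 * g 1 0) = t ^ 2 - 4 := by
    intro g hg
    have := g.det_coe
    rw [Matrix.det_fin_two] at this
    subst hg
    linarith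
  have ht2 : t ^ 2 ≤ 1 := by rw [← sq_abs]; nlinarith [abs_nonneg t]
  have hc : g 1 0 ≠ 0 := by
    intro h
    have := key g hg
    rw [h] at this
    nlinarith [sq_nonneg (2 * g 0 0 - t)]
  obtain ⟨n, hn⟩ : ∃ n : ℤ, |2 * (g 0 0 + n * g 1 0) - t| ≤ |g 1 0| ∧
      (|g 1 0| = 1 → g 0 0 + n * g 1 0 = 0) := by
    by_cases h1 : |g 1 0| = 1
    · have h2 : g 1 0 * g 1 0 = 1 := by rw [← abs_mul_abs_self, h1]; rfl
      have h3 : g 0 0 + -(g 0 0 * g 1 0) * g 1 0 = 0 := by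
        rw [neg_mul, mul_assoc, h2]; ring
      refine ⟨-(g 0 0 * g 1 0), ?_, fun _ ↦ h3⟩
      rw [h3, h1]
      simpa using ht
    · obtain ⟨n, hn⟩ := Int.exists_abs_two_mul_add_sub_le (g 0 0) t hc
      exact ⟨n, hn, fun h ↦ absurd h h1⟩
  obtain ⟨hn, hn1⟩ := hn
  set g' : SL(2, ℤ) := T ^ n * g * (T ^ n)⁻¹ with hg'
  have hconj : IsConj g g' := isConj_iff.2 ⟨T ^ n, rfl⟩
  have hcoe := coe_T_zpow_conj g n
  rw [← hg'] at hcoe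
  have e00 : g' 0 0 = g 0 0 + n * g 1 0 := by simp [hcoe]
  have e10 : g' 1 0 = g 1 0 := by simp [hcoe]
  have e11 : g' 1 1 = g 1 1 - n * g 1 0 := by simp [hcoe]
  have htr : g' 0 0 + g' 1 1 = t := by rw [e00, e11]; linarith
  rw [← e00, ← e10] at hn hn1
  rw [← e10] at hc hk
  have hdet := key g' htr
  clear_value g'
  by_cases h1 : |g' 1 0| = 1
  · have h0 := hn1 h1
    have h11 : g' 1 1 = t := by linarith
    rw [h0] at hdet
    rcases (abs_eq zero_le_one).1 h1 with h | h
    · left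
      convert hconj using 1
      ext i j
      have h01 : g' 0 1 = -1 := by rw [h] at hdet; linarith
      fin_cases i <;> fin_cases j <;>
        simp [coe_T_zpow, coe_S, h, h0, h01, h11]
    · right
      convert hconj using 1
      ext i j
      have h01 : g' 0 1 = 1 := by rw [h] at hdet; linarith
      fin_cases i <;> fin_cases j <;>
        simp [coe_T_zpow, coe_S, h, h0, h01, h11]
  · have hS := coe_S_conj g'
    have hconj' : IsConj g (S * g' * S⁻¹) := hconj.trans (isConj_iff.2 ⟨S, rfl⟩)
    have hlt : |g' 0 1| < |g' 1 0| := by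
      have hpos : 0 < |g' 1 0| := abs_pos.2 hc
      have h2 : 2 ≤ |g' 1 0| := by omega
      by_contra! hle
      have h3 : (2 * g' 0 0 - t) ^ 2 ≤ |g' 1 0| ^ 2 := by
        rw [← sq_abs (2 * g' 0 0 - t)]
        gcongr
      have h4 : |g' 0 1| * |g' 1 0| ≤ -(g' 0 1 * g' 1 0) := by
        rw [← abs_mul, abs_of_nonpos]
        nlinarith [sq_nonneg (2 * g' 0 0 - t)]
      nlinarith [mul_le_mul_of_nonneg_right hle hpos.le, sq_nonneg t]
    rcases ih _ (by rw [← hk]; simpa [hS] using Int.natAbs_lt_iff_sq_lt.2 (sq_lt_sq.2 hlt))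
      (S * g' * S⁻¹) (by simp [hS]; linarith) rfl with h | h
    · exact .inl (hconj'.trans h)
    · exact .inr (hconj'.trans h)

/-- A finite-index subgroup containing `-I` gives a transitive permutation representation in which
`-I` acts trivially and every element of the subgroup has a fixed point. -/
lemma exists_hom_perm_fin (H : Subgroup SL(2, ℤ)) (hneg : (-1 : SL(2, ℤ)) ∈ H) {n : ℕ}
    (hn : n ≠ 0) (hidx : H.index = n) :
    ∃ φ : SL(2, ℤ) →* Equiv.Perm (Fin n), φ (-1) = 1 ∧ (∀ x y, ∃ g, φ g x = y) ∧
      ∀ g ∈ H, ∃ x, φ g x = x := by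
  have : Finite (SL(2, ℤ) ⧸ H) := Nat.finite_of_card_ne_zero (by rwa [← hidx] at hn)
  let e : (SL(2, ℤ) ⧸ H) ≃ Fin n := Finite.equivFinOfCardEq hidx
  refine ⟨(e.permCongrHom.toMonoidHom).comp (MulAction.toPermHom SL(2, ℤ) (SL(2, ℤ) ⧸ H)),
    ?_, ?_, ?_⟩
  · ext x : 1
    obtain ⟨x, rfl⟩ := e.surjective x
    induction x using QuotientGroup.induction_on with
    | H x =>
      have : ((-1 : SL(2, ℤ)) • (x : SL(2, ℤ) ⧸ H)) = x := by
        rw [MulAction.Quotient.smul_coe, eq_comm, QuotientGroup.eq]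
        simpa using hneg
      simp [Equiv.permCongrHom, this]
  · intro x y
    obtain ⟨g, hg⟩ := MulAction.exists_smul_eq SL(2, ℤ) (e.symm x) (e.symm y)
    exact ⟨g, by simp [Equiv.permCongrHom, hg]⟩
  · intro g hg
    refine ⟨e ((1 : SL(2, ℤ)) : SL(2, ℤ) ⧸ H), ?_⟩
    have : (g • ((1 : SL(2, ℤ)) : SL(2, ℤ) ⧸ H)) = (1 : SL(2, ℤ)) := by
      rw [MulAction.Quotient.smul_coe, eq_comm, QuotientGroup.eq]
      simpa using hg
    simp [Equiv.permCongrHom, this]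

lemma IsConj.exists_fixed_point {G α : Type*} [Group G] (φ : G →* Equiv.Perm α) {g k : G}
    (h : IsConj g k) (hg : ∃ x, φ g x = x) : ∃ x, φ k x = x := by
  obtain ⟨c, rfl⟩ := isConj_iff.1 h
  obtain ⟨x, hx⟩ := hg
  exact ⟨φ c x, by simp [hx]⟩

open ModularGroup in
lemma S_sq_eq_neg_one : S ^ 2 = (-1 : SL(2, ℤ)) := by
  ext i j; fin_cases i <;> fin_cases j <;> decide

open ModularGroup in
lemma S_mul_T_pow_three_eq_neg_one : (S * T) ^ 3 = (-1 : SL(2, ℤ)) := by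
  ext i j; fin_cases i <;> fin_cases j <;> decide

open ModularGroup in
lemma S_mul_T_inv_eq_conj : S * T⁻¹ = -(S * (S * T)⁻¹ * S⁻¹) := by
  ext i j; fin_cases i <;> fin_cases j <;> decide

open ModularGroup in
lemma exists_fixed_point_of_natAbs_trace {α : Type*} (φ : SL(2, ℤ) →* Equiv.Perm α)
    (hφ : φ (-1) = 1) (g : SL(2, ℤ)) (hg : ∃ x, φ g x = x) :
    ((Matrix.trace (g : Matrix (Fin 2) (Fin 2) ℤ)).natAbs = 0 → ∃ x, φ S x = x) ∧
    ((Matrix.trace (g : Matrix (Fin 2) (Fin 2) ℤ)).natAbs = 1 → ∃ x, φ (S * T) x = x) := by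
  have hneg : ∀ k : SL(2, ℤ), φ (-k) = φ k := fun k ↦ by
    rw [← neg_one_mul, map_mul, hφ, one_mul]
  have hinv : (∃ x, φ (S * T⁻¹) x = x) → ∃ x, φ (S * T) x = x := by
    rw [S_mul_T_inv_eq_conj, hneg]
    intro h
    obtain ⟨x, hx⟩ := IsConj.exists_fixed_point φ
      (isConj_iff.2 ⟨S⁻¹, by group⟩ : IsConj (S * (S * T)⁻¹ * S⁻¹) (S * T)⁻¹) h
    refine ⟨x, ?_⟩
    rw [map_inv, Equiv.Perm.inv_eq_iff_eq] at hx
    exact hx.symm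
  rw [Matrix.trace_fin_two]
  constructor
  · intro h
    rcases isConj_of_abs_trace_le_one g 0 (by simp) (by omega) with h | h
    · simpa using h.exists_fixed_point φ hg
    · simpa [hneg] using h.exists_fixed_point φ hg
  · intro h
    rcases Int.natAbs_eq_iff.1 h with h | h
    · rcases isConj_of_abs_trace_le_one g 1 (by simp) (by simpa using h) with h | h
      · simpa only [zpow_one] using h.exists_fixed_point φ hg
      · have := h.exists_fixed_point φ hg
        rw [hneg, zpow_neg_one] at this
        exact hinv this
    · rcases isConj_of_abs_trace_le_one g (-1) (by simp) (by simpa using h) with h | h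
      · have := h.exists_fixed_point φ hg
        rw [zpow_neg_one] at this
        exact hinv this
      · have := h.exists_fixed_point φ hg
        rwa [hneg, neg_neg, zpow_one] at this

open ModularGroup in
lemma hom_mem_of_S_T_mem {G : Type*} [Group G] (φ : SL(2, ℤ) →* G) (K : Subgroup G)
    (hS : φ S ∈ K) (hT : φ T ∈ K) (g : SL(2, ℤ)) : φ g ∈ K := by
  have : Subgroup.closure {S, T} ≤ K.comap φ := by
    rw [Subgroup.closure_le]
    rintro _ (rfl | rfl) <;> assumption
  rw [SpecialLinearGroup.SL2Z_generators] at this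
  exact this (Subgroup.mem_top g)

/-- No subgroup of `SL(2, ℤ)` containing `-I` of index `2` or `3` (equivalently, no subgroup
of `PSL₂(ℤ)` of index `2` or `3`) has absolute trace set all of `ℕ`. -/
theorem index_two_or_three_not_full_trace_set (H : Subgroup SL(2, ℤ))
    (hneg : (-1 : SL(2, ℤ)) ∈ H) (hidx : H.index = 2 ∨ H.index = 3) :
    absTraceSet H ≠ Set.univ := by
  intro huniv
  rcases hidx with hidx | hidx
  · obtain ⟨φ, hφ, htrans, hfix⟩ := exists_hom_perm_fin H hneg two_ne_zero hidx
    obtain ⟨g, hgH, hg⟩ : 0 ∈ absTraceSet H := huniv ▸ Set.mem_univ 0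
    have hS : φ ModularGroup.S = 1 :=
      (by decide : ∀ σ : Equiv.Perm (Fin 2), (∃ x, σ x = x) → σ = 1) _
        ((exists_fixed_point_of_natAbs_trace φ hφ g (hfix g hgH)).1 hg)
    have hT : φ ModularGroup.T = 1 := by
      have h3 : φ (ModularGroup.S * ModularGroup.T) ^ 3 = 1 := by
        rw [← map_pow, S_mul_T_pow_three_eq_neg_one, hφ]
      rw [map_mul, hS, one_mul] at h3
      exact (by decide : ∀ σ : Equiv.Perm (Fin 2), σ ^ 3 = 1 → σ = 1) _ h3
    obtain ⟨k, hk⟩ := htrans 0 1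
    have := hom_mem_of_S_T_mem φ ⊥ hS hT k
    rw [Subgroup.mem_bot] at this
    simp [this] at hk
  · obtain ⟨φ, hφ, htrans, hfix⟩ := exists_hom_perm_fin H hneg three_ne_zero hidx
    obtain ⟨g, hgH, hg⟩ : 1 ∈ absTraceSet H := huniv ▸ Set.mem_univ 1
    have hST : φ (ModularGroup.S * ModularGroup.T) = 1 := by
      have h3 : φ (ModularGroup.S * ModularGroup.T) ^ 3 = 1 := by
        rw [← map_pow, S_mul_T_pow_three_eq_neg_one, hφ]
      exact (by decide : ∀ σ : Equiv.Perm (Fin 3), σ ^ 3 = 1 → (∃ x, σ x = x) → σ = 1) _ h3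
        ((exists_fixed_point_of_natAbs_trace φ hφ g (hfix g hgH)).2 hg)
    have hS : φ ModularGroup.S ^ 2 = 1 := by rw [← map_pow, S_sq_eq_neg_one, hφ]
    have hT : φ ModularGroup.T = (φ ModularGroup.S)⁻¹ := by
      rw [map_mul] at hST
      exact eq_inv_of_mul_eq_one_right hST
    obtain ⟨z, hz0, hz1⟩ := (by decide : ∀ y : Fin 3, ∃ z, z ≠ 0 ∧ z ≠ y) (φ ModularGroup.S 0)
    obtain ⟨k, hk⟩ := htrans 0 z
    obtain ⟨m, hm⟩ := Subgroup.mem_zpowers_iff.1 <|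
      hom_mem_of_S_T_mem φ (Subgroup.zpowers (φ ModularGroup.S)) (Subgroup.mem_zpowers _)
        (hT ▸ inv_mem (Subgroup.mem_zpowers _)) k
    rw [← hm] at hk
    rcases Int.even_or_odd' m with ⟨r, rfl | rfl⟩
    · rw [zpow_mul, zpow_ofNat, hS, one_zpow] at hk
      exact hz0 hk.symm
    · rw [zpow_add_one, zpow_mul, zpow_ofNat, hS, one_zpow, one_mul] at hk
      exact hz1 hk.symm
end
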